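/- arXiv:2405.10636 — 2 statements merged into one kernel-verified Lean document; each statement's English description precedes it below -/
import Mathlib

section
/- Let M > 0, γ₀ > 0, ρ > 0, and for each n ∈ ℤ² let μ_n be a Borel probability measure on ℝ with μ_n([0,M]) = 1 and μ_n({s : |s − t| > γ₀/2}) ≥ ρ for every t ∈ [0,M]. There exist α > 1 > ε > 0 (depending on M, γ₀, ρ) such that: for every Ē ∈ [0, 8+M], all integers a, b ≥ 2 with a ≥ α·b²·log a ≥ α², every F ⊆ ℤ² that is ε-sparse in R := R_{[1,a],[1,b]}, and every v : F → [0,M], the product measure ⊗_{n∈R\F} μ_n of the set of configurations ω : R\F → ℝ with the following property is at least 1 − e^{−εa}: writing V = v on F and V = ω on R\F, for every E ∈ ℝ and every ψ : ℤ² → ℝ, the four conditions |E − Ē| ≤ e^{−α·b·log a}, Hψ = Eψ in R°, |ψ(n)| ≤ 1 for all n ∈ R_{[1,a],[1,2]}, and |{n ∈ R_{[1,a],[b−1,b]}\F : |ψ(n)| ≤ 1}| ≥ (1−ε)·|R_{[1,a],[b−1,b]}\F| together imply |ψ(n)| ≤ e^{α·b·log a} for every n ∈ R. -/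
open MeasureTheory ProbabilityTheory
open scoped Classical

noncomputable section

/-- Euclidean distance between two points of `ℤ²`. -/
def eudist (x y : ℤ × ℤ) : ℝ :=
  Real.sqrt ((((x.1 - y.1 : ℤ) : ℝ)) ^ 2 + (((x.2 - y.2 : ℤ) : ℝ)) ^ 2)

/-- The square `([a, a+L−1] × [b, b+L−1]) ∩ ℤ²` of side length `L`. -/
def sqZ (a b : ℤ) (L : ℕ) : Finset (ℤ × ℤ) :=
  Finset.Icc a (a + L - 1) ×ˢ Finset.Icc b (b + L - 1)

/-- The truncated Hamiltonian `H_Λ`: the `Λ×Λ` matrix with diagonal entries `4 + V x`,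
entries `−1` between nearest neighbours (`‖x−y‖₁ = 1`) and `0` otherwise. -/
def Ham (V : ℤ × ℤ → ℝ) (Λ : Finset (ℤ × ℤ)) : Matrix Λ Λ ℝ :=
  fun x y =>
    if (x : ℤ × ℤ) = (y : ℤ × ℤ) then 4 + V x
    else if ((x : ℤ × ℤ).1 - (y : ℤ × ℤ).1).natAbs + ((x : ℤ × ℤ).2 - (y : ℤ × ℤ).2).natAbs = 1
      then -1 else 0

/-- Entries of a `Λ×Λ` matrix, extended by `0` outside `Λ`. -/
def entry {Λ : Finset (ℤ × ℤ)} (A : Matrix Λ Λ ℝ) (x y : ℤ × ℤ) : ℝ :=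
  if hx : x ∈ Λ then (if hy : y ∈ Λ then A ⟨x, hx⟩ ⟨y, hy⟩ else 0) else 0

/-- Extension by zero of a potential defined on `Λ`. -/
def extV (Λ : Finset (ℤ × ℤ)) (V : Λ → ℝ) : ℤ × ℤ → ℝ :=
  fun n => if h : n ∈ Λ then V ⟨n, h⟩ else 0

/-- `ψ` satisfies `Hψ = Eψ` (with potential `V`) at every site of `S`. -/
def EigOn (V : ℤ × ℤ → ℝ) (E : ℝ) (ψ : ℤ × ℤ → ℝ) (S : Set (ℤ × ℤ)) : Prop :=
  ∀ n ∈ S, (4 + V n) * ψ n - ψ (n.1 + 1, n.2) - ψ (n.1 - 1, n.2)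
      - ψ (n.1, n.2 + 1) - ψ (n.1, n.2 - 1) = E * ψ n

/-- The tilted rectangle `{n : a₁ ≤ s(n) ≤ a₂, b₁ ≤ t(n) ≤ b₂}` in the tilted
coordinates `s = x + y`, `t = x − y`. -/
def tRect (a₁ a₂ b₁ b₂ : ℤ) : Set (ℤ × ℤ) :=
  {n | a₁ ≤ n.1 + n.2 ∧ n.1 + n.2 ≤ a₂ ∧ b₁ ≤ n.1 - n.2 ∧ n.1 - n.2 ≤ b₂}

/-- The tilted rectangle as a finite set. -/
def tRectF (a₁ a₂ b₁ b₂ : ℤ) : Finset (ℤ × ℤ) :=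
  ((Finset.Icc (-(|a₁| + |a₂| + |b₁| + |b₂|)) (|a₁| + |a₂| + |b₁| + |b₂|)) ×ˢ
    (Finset.Icc (-(|a₁| + |a₂| + |b₁| + |b₂|)) (|a₁| + |a₂| + |b₁| + |b₂|))).filter
    (fun n => a₁ ≤ n.1 + n.2 ∧ n.1 + n.2 ≤ a₂ ∧ b₁ ≤ n.1 - n.2 ∧ n.1 - n.2 ≤ b₂)

/-- `F` is `ε`-sparse in `R`: along every diagonal (in either tilted direction),
`F` occupies at most an `ε` fraction of `R`. -/
def SparseIn (ε : ℝ) (F R : Set (ℤ × ℤ)) : Prop :=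
  ∀ k : ℤ,
    ((F ∩ R ∩ {n | n.1 + n.2 = k}).ncard : ℝ) ≤ ε * ((R ∩ {n | n.1 + n.2 = k}).ncard : ℝ) ∧
    ((F ∩ R ∩ {n | n.1 - n.2 = k}).ncard : ℝ) ≤ ε * ((R ∩ {n | n.1 - n.2 = k}).ncard : ℝ)

/-- A tilted square: a tilted rectangle with equal side lengths. -/
def IsTiltedSquare (Q : Set (ℤ × ℤ)) : Prop :=
  ∃ (c d : ℤ) (a : ℕ), 0 < a ∧ Q = tRect c (c + a - 1) d (d + a - 1)

/-- `F` is `ε`-regular in `Λ`: any finite disjoint collection of tilted squares inside `Λ`,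
in none of which `F` is `ε`-sparse, covers at most an `ε` fraction of `Λ`. -/
def RegularIn (ε : ℝ) (F : Set (ℤ × ℤ)) (Λ : Set (ℤ × ℤ)) : Prop :=
  ∀ (m : ℕ) (Q : Fin m → Set (ℤ × ℤ)),
    (∀ i, IsTiltedSquare (Q i)) → (∀ i, Q i ⊆ Λ) →
    Pairwise (Function.onFun Disjoint Q) →
    (∀ i, ¬ SparseIn ε F (Q i)) →
    ((⋃ i, Q i).ncard : ℝ) ≤ ε * (Λ.ncard : ℝ)

/-- The lattice points of the axis-parallel square concentric with the square
`sqZ a b L` whose area is `c` times that of `sqZ a b L`. -/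
def scaledSq (a b : ℤ) (L : ℕ) (c : ℝ) : Set (ℤ × ℤ) :=
  {n | |(n.1 : ℝ) - ((a : ℝ) + ((L : ℝ) - 1) / 2)| ≤ Real.sqrt c * L / 2 ∧
       |(n.2 : ℝ) - ((b : ℝ) + ((L : ℝ) - 1) / 2)| ≤ Real.sqrt c * L / 2}

/-- The lattice points of the tilted square concentric with the tilted square
`tRect c (c+a−1) d (d+a−1)` whose area is `r` times as large. -/
def scaledTSq (c d : ℤ) (a : ℕ) (r : ℝ) : Set (ℤ × ℤ) :=
  {n | |((n.1 + n.2 : ℤ) : ℝ) - ((c : ℝ) + ((a : ℝ) - 1) / 2)| ≤ Real.sqrt r * a / 2 ∧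
       |((n.1 - n.2 : ℤ) : ℝ) - ((d : ℝ) + ((a : ℝ) - 1) / 2)| ≤ Real.sqrt r * a / 2}

/-- The scaled tilted square as a finite set. -/
def scaledTSqF (c d : ℤ) (a : ℕ) (r : ℝ) : Finset (ℤ × ℤ) :=
  (tRectF (c - ⌈Real.sqrt r * a⌉ - a) (c + a + ⌈Real.sqrt r * a⌉)
      (d - ⌈Real.sqrt r * a⌉ - a) (d + a + ⌈Real.sqrt r * a⌉)).filter
    (fun n => n ∈ scaledTSq c d a r)

/-- The boundary of `Λ'` inside `Λ`: pairs `(u,v)` with `u ∈ Λ'`, `v ∈ Λ \ Λ'`,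
`‖u − v‖₁ = 1`. -/
def bdry (Λ Λ' : Finset (ℤ × ℤ)) : Finset ((ℤ × ℤ) × (ℤ × ℤ)) :=
  (Λ' ×ˢ (Λ \ Λ')).filter
    (fun uv => (uv.1.1 - uv.2.1).natAbs + (uv.1.2 - uv.2.2).natAbs = 1)



/-- The solution in the quadrant of
`u (s+2) (t+2) = g (s+1) (t+1) * u (s+1) (t+1) - u (s+2) t - u s (t+2) - u s t`
which equals `f` wherever `s < 2` or `t < 2`. -/
def quadrantSol (g f : ℕ → ℕ → ℝ) : ℕ → ℕ → ℝ
  | 0, t => f 0 t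
  | 1, t => f 1 t
  | s + 2, 0 => f (s + 2) 0
  | s + 2, 1 => f (s + 2) 1
  | s + 2, t + 2 => g (s + 1) (t + 1) * quadrantSol g f (s + 1) (t + 1)
      - quadrantSol g f (s + 2) t - quadrantSol g f s (t + 2) - quadrantSol g f s t
  termination_by s t => (s, t)

lemma quadrantSol_step (g f : ℕ → ℕ → ℝ) (s t : ℕ) :
    quadrantSol g f (s + 2) (t + 2) = g (s + 1) (t + 1) * quadrantSol g f (s + 1) (t + 1)
      - quadrantSol g f (s + 2) t - quadrantSol g f s (t + 2) - quadrantSol g f s t := by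
  rw [quadrantSol]

lemma quadrantSol_col (g f : ℕ → ℕ → ℝ) {s : ℕ} (hs : s < 2) (t : ℕ) :
    quadrantSol g f s t = f s t := by
  interval_cases s <;> rw [quadrantSol]

lemma quadrantSol_row (g f : ℕ → ℕ → ℝ) (s : ℕ) {t : ℕ} (ht : t < 2) :
    quadrantSol g f s t = f s t := by
  rcases s with _ | _ | s
  · exact quadrantSol_col g f (by norm_num) t
  · exact quadrantSol_col g f (by norm_num) t
  · interval_cases t <;> rw [quadrantSol]

/-- The solution on column `s` only depends on the coefficients on the columns to its left. -/
lemma quadrantSol_congr {g g' : ℕ → ℕ → ℝ} (f : ℕ → ℕ → ℝ) :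
    ∀ s, (∀ s' < s, ∀ t, g s' t = g' s' t) → ∀ t, quadrantSol g f s t = quadrantSol g' f s t := by
  intro s
  induction s using Nat.strong_induction_on with
  | _ s ih =>
  intro h t
  rcases s with _ | _ | s
  · simp [quadrantSol_col]
  · simp [quadrantSol_col]
  induction t using Nat.strong_induction_on with
  | _ t iht =>
  rcases t with _ | _ | t
  · simp [quadrantSol_row]
  · simp [quadrantSol_row]
  rw [quadrantSol_step, quadrantSol_step, iht t (by omega), h (s + 1) (by omega),
    ih (s + 1) (by omega) (fun s' hs' => h s' (by omega)),
    ih s (by omega) (fun s' hs' => h s' (by omega)),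
    ih s (by omega) (fun s' hs' => h s' (by omega))]

/-- A change of the coefficient at `(p+1, m+1)` moves the solution on the next column by an exactly
alternating amount. -/
lemma quadrantSol_sub {g g' : ℕ → ℕ → ℝ} (f : ℕ → ℕ → ℝ) {p m : ℕ}
    (h : ∀ s t, (s, t) ≠ (p + 1, m + 1) → g s t = g' s t) (j : ℕ) :
    quadrantSol g f (p + 2) (m + 2 + 2 * j) - quadrantSol g' f (p + 2) (m + 2 + 2 * j) =
      (-1) ^ j * ((g (p + 1) (m + 1) - g' (p + 1) (m + 1)) * quadrantSol g f (p + 1) (m + 1)) := by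
  have hc : ∀ s ≤ p + 1, ∀ t, quadrantSol g f s t = quadrantSol g' f s t := fun s hs =>
    quadrantSol_congr f s fun s' hs' t => h s' t (by simp; omega)
  have hlow : ∀ t ≤ m + 1, quadrantSol g f (p + 2) t = quadrantSol g' f (p + 2) t := by
    intro t
    induction t using Nat.strong_induction_on with
    | _ t iht =>
    intro ht
    rcases t with _ | _ | t
    · simp [quadrantSol_row]
    · simp [quadrantSol_row]
    rw [quadrantSol_step, quadrantSol_step, iht t (by omega) (by omega),
      h (p + 1) (t + 1) (by simp; omega), hc (p + 1) le_rfl, hc p (by omega), hc p (by omega)]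
  induction j with
  | zero =>
    rw [mul_zero, add_zero, quadrantSol_step, quadrantSol_step, hlow m (by omega),
      hc (p + 1) le_rfl, hc p (by omega), hc p (by omega)]
    ring
  | succ j ih =>
    rw [show m + 2 + 2 * (j + 1) = (m + 2 + 2 * j) + 2 by ring, quadrantSol_step, quadrantSol_step,
      h (p + 1) (m + 2 + 2 * j + 1) (by simp; omega), hc (p + 1) le_rfl, hc p (by omega),
      hc p (by omega), pow_succ]
    linear_combination -ih

lemma measurable_quadrantSol {Ω : Type*} [MeasurableSpace Ω] {g : Ω → ℕ → ℕ → ℝ}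
    (f : ℕ → ℕ → ℝ) (hg : ∀ s t, Measurable fun ω => g ω s t) :
    ∀ s t, Measurable fun ω => quadrantSol (g ω) f s t := by
  intro s
  induction s using Nat.strong_induction_on with
  | _ s ih =>
  intro t
  rcases s with _ | _ | s
  · simp [quadrantSol_col]
  · simp [quadrantSol_col]
  induction t using Nat.strong_induction_on with
  | _ t iht =>
  rcases t with _ | _ | t
  · simp [quadrantSol_row]
  · simp [quadrantSol_row]
  simp only [quadrantSol_step]
  exact ((((hg _ _).mul (ih (s + 1) (by omega) _)).sub (iht t (by omega))).sub
    (ih s (by omega) _)).sub (ih s (by omega) _)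

lemma abs_add_le_of_recurrence {w g h : ℕ → ℕ → ℝ} {β : ℕ → ℝ} {K : ℝ} {s t : ℕ}
    (hrec : w (s + 2) (t + 2) = g (s + 1) (t + 1) * w (s + 1) (t + 1) - w (s + 2) t
      - w s (t + 2) - w s t + h s t)
    (hg : |g (s + 1) (t + 1)| ≤ K) (hh : |h s t| ≤ β (t + 1)) (hβ : β t ≤ β (t + 1))
    (h1 : |w (s + 1) (t + 1)| ≤ 2 * β (t + 1)) (h2 : |w (s + 2) t| ≤ 2 * β t)
    (h3 : |w s t| ≤ 2 * β t) :
    |w (s + 2) (t + 2) + w s (t + 2)| ≤ (2 * K + 5) * β (t + 1) := by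
  have e : w (s + 2) (t + 2) + w s (t + 2) =
      g (s + 1) (t + 1) * w (s + 1) (t + 1) - w (s + 2) t - w s t + h s t := by
    rw [hrec]; ring
  have hm : |g (s + 1) (t + 1) * w (s + 1) (t + 1)| ≤ K * (2 * β (t + 1)) := by
    rw [abs_mul]
    exact mul_le_mul hg h1 (abs_nonneg _) ((abs_nonneg _).trans hg)
  rw [e]
  rw [abs_le] at *
  constructor <;> linarith [hm.1, hm.2, h2.1, h2.2, h3.1, h3.2, hh.1, hh.2]

lemma abs_sub_abs_le_of_alternating {y : ℕ → ℝ} {a : ℕ} {c : ℝ}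
    (h : ∀ s, s + 2 < a → |y (s + 2) + y s| ≤ c) (hc : 0 ≤ c) :
    ∀ s < a, |(|y s| - |y (s % 2)|)| ≤ s * c := by
  intro s
  induction s using Nat.strong_induction_on with
  | _ s ih =>
  intro hs
  rcases s with _ | _ | s
  · simp
  · simpa using hc
  have h1 := ih s (by omega) (by omega)
  have h2 := h s hs
  have h3 : |(|y (s + 2)| - |y s|)| ≤ |y (s + 2) + y s| := by
    have := abs_abs_sub_abs_le_abs_sub (y (s + 2)) (-y s)
    rwa [abs_neg, sub_neg_eq_add] at this
  have h4 : (s + 2) % 2 = s % 2 := by omega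
  rw [show s + 1 + 1 = s + 2 from rfl, h4]
  have h5 : |y (s + 2)| - |y (s % 2)| = (|y (s + 2)| - |y s|) + (|y s| - |y (s % 2)|) := by ring
  rw [h5]
  refine (abs_add_le _ _).trans ?_
  push_cast
  linarith

/-- Growth bound for solutions of the inhomogeneous recurrence, line by line. -/
lemma abs_le_of_recurrence {w g h : ℕ → ℕ → ℝ} {β : ℕ → ℝ} {K : ℝ} {a T : ℕ} (ha : 1 ≤ a)
    (hK : 0 ≤ K)
    (hrec : ∀ s t, s + 2 < a → t + 2 < T → w (s + 2) (t + 2) =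
      g (s + 1) (t + 1) * w (s + 1) (t + 1) - w (s + 2) t - w s (t + 2) - w s t + h s t)
    (hg : ∀ s t, s + 2 < a → t + 2 < T → |g (s + 1) (t + 1)| ≤ K)
    (hh : ∀ s t, s + 2 < a → t + 2 < T → |h s t| ≤ β (t + 1))
    (hβ0 : ∀ t, 0 ≤ β t) (hβ : ∀ t, a * (2 * K + 5) * β t ≤ β (t + 1))
    (hcol : ∀ s t, s < 2 → t < T → |w s t| ≤ β t)
    (hrow : ∀ s t, s < a → t < 2 → t < T → |w s t| ≤ 2 * β t) :
    ∀ t < T, ∀ s < a, |w s t| ≤ 2 * β t := by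
  have ha' : (1 : ℝ) ≤ a := by exact_mod_cast ha
  have hmono : ∀ t, β t ≤ β (t + 1) := fun t => by
    refine le_trans ?_ (hβ t)
    nlinarith [hβ0 t, mul_nonneg (sub_nonneg.2 ha') (hβ0 t), mul_nonneg hK (hβ0 t),
      mul_nonneg (sub_nonneg.2 ha') (mul_nonneg hK (hβ0 t))]
  intro t
  induction t using Nat.strong_induction_on with
  | _ t ih =>
  intro ht s hs
  rcases lt_or_ge t 2 with h2 | h2
  · exact hrow s t hs h2 ht
  obtain ⟨t, rfl⟩ := Nat.exists_eq_add_of_le' h2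
  have hstep : ∀ s, s + 2 < a → |w (s + 2) (t + 2) + w s (t + 2)| ≤ (2 * K + 5) * β (t + 1) :=
    fun s hs => abs_add_le_of_recurrence (hrec s t hs ht) (hg s t hs ht) (hh s t hs ht) (hmono t)
      (ih _ (by omega) (by omega) _ (by omega)) (ih _ (by omega) (by omega) _ (by omega))
      (ih _ (by omega) (by omega) _ (by omega))
  have hnn : 0 ≤ (2 * K + 5) * β (t + 1) := mul_nonneg (by linarith) (hβ0 _)
  have h3 := abs_sub_abs_le_of_alternating (y := fun s => w s (t + 2)) hstep hnn s hs
  have h4 := hcol (s % 2) (t + 2) (Nat.mod_lt _ (by norm_num)) ht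
  have h5 := hβ (t + 1)
  have h6 : (s : ℝ) * ((2 * K + 5) * β (t + 1)) ≤ a * ((2 * K + 5) * β (t + 1)) :=
    mul_le_mul_of_nonneg_right (by exact_mod_cast hs.le) hnn
  have h7 := (abs_le.1 h3).2
  linarith

/-- If the boundary column first reaches the increasing threshold `β` on line `k`, then the solution
is large on the whole of line `k`. -/
lemma half_le_abs_quadrantSol {g f : ℕ → ℕ → ℝ} {β : ℕ → ℝ} {K : ℝ} {a k : ℕ} (ha : 1 ≤ a)
    (hK : 0 ≤ K) (hg : ∀ s t, |g s t| ≤ K) (hβ0 : ∀ t, 0 ≤ β t)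
    (hβ : ∀ t, 2 * (a * (2 * K + 5)) * β t ≤ β (t + 1)) (hrow : ∀ s t, t < 2 → f s t = 0)
    (hk : 2 ≤ k) (hcol : ∀ s t, s < 2 → t < k → |f s t| ≤ β t) {s : ℕ} (hs : s < a)
    (hfs : β k ≤ |f (s % 2) k|) : β k / 2 ≤ |quadrantSol g f s k| := by
  have ha' : (1 : ℝ) ≤ a := by exact_mod_cast ha
  have hpos : 0 ≤ (a : ℝ) * (2 * K + 5) := by positivity
  have hβ' : ∀ t, a * (2 * K + 5) * β t ≤ β (t + 1) := fun t => by
    have := mul_nonneg hpos (hβ0 t)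
    linarith [hβ t]
  have hmono : ∀ t, β t ≤ β (t + 1) := fun t => by
    refine le_trans ?_ (hβ' t)
    nlinarith [hβ0 t, mul_nonneg (sub_nonneg.2 ha') (hβ0 t), mul_nonneg hK (hβ0 t),
      mul_nonneg (sub_nonneg.2 ha') (mul_nonneg hK (hβ0 t))]
  have hbd : ∀ t < k, ∀ s < a, |quadrantSol g f s t| ≤ 2 * β t := by
    refine abs_le_of_recurrence (g := g) (h := fun _ _ => 0) ha hK
      (fun s t _ _ => by rw [quadrantSol_step, add_zero]) (fun s t _ _ => hg _ _)
      (fun s t _ _ => by simpa using hβ0 _) hβ0 hβ' ?_ ?_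
    · intro s t hs ht
      rw [quadrantSol_col g f hs]
      exact hcol s t hs ht
    · intro s t _ ht _
      rw [quadrantSol_row g f s ht, hrow s t ht]
      simpa using hβ0 t
  obtain ⟨t, rfl⟩ := Nat.exists_eq_add_of_le' hk
  have hstep : ∀ s, s + 2 < a →
      |quadrantSol g f (s + 2) (t + 2) + quadrantSol g f s (t + 2)| ≤ (2 * K + 5) * β (t + 1) :=
    fun s hs => abs_add_le_of_recurrence (g := g) (h := fun _ _ => 0)
      (by rw [quadrantSol_step, add_zero]) (hg _ _)
      (by simpa using hβ0 _) (hmono t) (hbd _ (by omega) _ (by omega))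
      (hbd _ (by omega) _ (by omega)) (hbd _ (by omega) _ (by omega))
  have hnn : 0 ≤ (2 * K + 5) * β (t + 1) := mul_nonneg (by linarith) (hβ0 _)
  have h3 := abs_sub_abs_le_of_alternating (y := fun s => quadrantSol g f s (t + 2)) hstep hnn s hs
  rw [quadrantSol_col g f (Nat.mod_lt s (by norm_num))] at h3
  have h5 := hβ (t + 1)
  have h6 : (s : ℝ) * ((2 * K + 5) * β (t + 1)) ≤ a * ((2 * K + 5) * β (t + 1)) :=
    mul_le_mul_of_nonneg_right (by exact_mod_cast hs.le) hnn
  have h7 := (abs_le.1 h3).1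
  rw [show t + 1 + 1 = t + 2 from rfl] at h5
  linarith

open scoped ENNReal

lemma lintegral_pi_update {ι : Type*} [Fintype ι] (μ : ι → Measure ℝ)
    [∀ i, IsProbabilityMeasure (μ i)] (i : ι) {f : (ι → ℝ) → ℝ≥0∞} (hf : Measurable f) :
    ∫⁻ ω, f ω ∂Measure.pi μ =
      ∫⁻ ω, ∫⁻ x, f (Function.update ω i x) ∂μ i ∂Measure.pi μ := by
  have h1 : ∀ F : (ι → ℝ) → ℝ≥0∞, ∫⁻ ω, F ω ∂Measure.pi μ =
      (∫⋯∫⁻_Finset.univ, F ∂μ) 0 := fun F => lintegral_eq_lmarginal_univ 0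
  have h2 : Measurable fun ω => ∫⁻ x, f (Function.update ω i x) ∂μ i := by
    have := hf.lmarginal μ (s := {i})
    simpa [lmarginal_singleton] using this
  rw [h1, h1, lmarginal_erase' _ hf (Finset.mem_univ i),
    lmarginal_erase' _ h2 (Finset.mem_univ i)]
  simp

lemma lintegral_pi_prod_le {ι : Type*} [Fintype ι] (μ : ι → Measure ℝ)
    [∀ i, IsProbabilityMeasure (μ i)] (idx : ℕ → ι) (Y : ℕ → (ι → ℝ) → ℝ≥0∞) (q : ℝ≥0∞)
    (hY : ∀ s, Measurable (Y s)) (J : Finset ℕ)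
    (hq : ∀ s ∈ J, ∀ ω, ∫⁻ x, Y s (Function.update ω (idx s) x) ∂μ (idx s) ≤ q)
    (hind : ∀ s ∈ J, ∀ s' < s, ∀ ω x, Y s' (Function.update ω (idx s) x) = Y s' ω) :
    ∫⁻ ω, ∏ s ∈ J, Y s ω ∂Measure.pi μ ≤ q ^ J.card := by
  induction J using Finset.induction_on_max with
  | empty => simp
  | insert m J hm ih =>
    have hmJ : m ∉ J := fun h => lt_irrefl m (hm m h)
    have hmeas : Measurable fun ω => ∏ s ∈ J, Y s ω := Finset.measurable_fun_prod J fun s _ => hY s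
    rw [lintegral_pi_update μ (idx m) (Finset.measurable_fun_prod _ fun s _ => hY s)]
    calc ∫⁻ ω, ∫⁻ x, ∏ s ∈ insert m J, Y s (Function.update ω (idx m) x) ∂μ (idx m) ∂Measure.pi μ
        ≤ ∫⁻ ω, q * ∏ s ∈ J, Y s ω ∂Measure.pi μ := by
          refine lintegral_mono fun ω => ?_
          have e : ∀ x, ∏ s ∈ insert m J, Y s (Function.update ω (idx m) x) =
              Y m (Function.update ω (idx m) x) * ∏ s ∈ J, Y s ω := fun x => by
            rw [Finset.prod_insert hmJ]
            congr 1
            exact Finset.prod_congr rfl fun s hs =>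
              hind m (Finset.mem_insert_self _ _) s (hm s hs) ω x
          simp only [e]
          rw [lintegral_mul_const _ (show Measurable fun x => Y m (Function.update ω (idx m) x) from
            (hY m).comp (measurable_update ω))]
          gcongr
          exact hq m (Finset.mem_insert_self _ _) ω
      _ ≤ q * q ^ J.card := by
          rw [lintegral_const_mul _ hmeas]
          gcongr
          exact ih (fun s hs => hq s (Finset.mem_insert_of_mem hs))
            fun s hs => hind s (Finset.mem_insert_of_mem hs)
      _ = q ^ (insert m J).card := by rw [Finset.card_insert_of_notMem hmJ, pow_succ']

lemma measure_clamp_near_le {ν : Measure ℝ} [IsProbabilityMeasure ν] {M γ ρ : ℝ}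
    (hρ : 0 ≤ ρ) (hsupp : ν (Set.Icc 0 M) = 1)
    (hac : ∀ t ∈ Set.Icc (0:ℝ) M, ENNReal.ofReal ρ ≤ ν {s | γ < |s - t|})
    {c : ℝ} (hc : c ∈ Set.Icc 0 M) :
    ν {x | |max 0 (min M x) - c| ≤ γ} ≤ ENNReal.ofReal (1 - ρ) := by
  have hm : MeasurableSet {s : ℝ | γ < |s - c|} :=
    measurableSet_lt measurable_const (by fun_prop)
  have hae : ∀ᵐ x ∂ν, x ∈ Set.Icc 0 M :=
    (mem_ae_iff_prob_eq_one measurableSet_Icc).2 hsupp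
  calc ν {x | |max 0 (min M x) - c| ≤ γ} ≤ ν {s | γ < |s - c|}ᶜ := by
        refine measure_mono_ae ?_
        filter_upwards [hae] with x hx
        intro h
        change |max 0 (min M x) - c| ≤ γ at h
        rw [min_eq_right hx.2, max_eq_right hx.1] at h
        exact not_lt.2 h
    _ = 1 - ν {s | γ < |s - c|} := prob_compl_eq_one_sub hm
    _ ≤ 1 - ENNReal.ofReal ρ := tsub_le_tsub_left (hac c hc) 1
    _ = ENNReal.ofReal (1 - ρ) := by rw [ENNReal.ofReal_sub _ hρ, ENNReal.ofReal_one]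

lemma ite_half_eq (p : Prop) : (if p then (1 : ℝ≥0∞) else 2⁻¹) = 2⁻¹ + 2⁻¹ * (if p then 1 else 0) := by
  split_ifs
  · rw [mul_one, ENNReal.inv_two_add_inv_two]
  · simp

/-- Along a line `k` on which the solution is always at least `τ`, the independent coefficients
spread the values of the solution on a higher line `k + 1 + 2 * j`. -/
lemma measure_few_large_le {ι : Type*} [Fintype ι] (μ : ι → Measure ℝ)
    [∀ i, IsProbabilityMeasure (μ i)] {M γ ρ τ r : ℝ} (hM : 0 ≤ M) (hρ : 0 ≤ ρ) (hρ1 : ρ ≤ 1)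
    (hsupp : ∀ i, μ i (Set.Icc 0 M) = 1)
    (hac : ∀ i, ∀ t ∈ Set.Icc (0:ℝ) M, ENNReal.ofReal ρ ≤ μ i {s | γ < |s - t|})
    (g : (ι → ℝ) → ℕ → ℕ → ℝ) (f : ℕ → ℕ → ℝ) (hgm : ∀ s t, Measurable fun ω => g ω s t)
    {k : ℕ} (hk : 1 ≤ k) (j : ℕ) (J : Finset ℕ) (hJ : ∀ s ∈ J, 1 ≤ s) (idx : ℕ → ι) (c : ℝ)
    (hg1 : ∀ s ∈ J, ∀ ω x s' t', (s', t') ≠ (s, k) →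
      g (Function.update ω (idx s) x) s' t' = g ω s' t')
    (hg2 : ∀ s ∈ J, ∀ ω x, g (Function.update ω (idx s) x) s k = c + max 0 (min M x))
    (hτ : 0 < τ) (hlow : ∀ s ∈ J, ∀ ω, τ ≤ |quadrantSol (g ω) f s k|) (hr : 2 * r ≤ γ * τ)
    (m : ℕ) :
    Measure.pi μ {ω | (J.filter fun s => r < |quadrantSol (g ω) f (s + 1) (k + 1 + 2 * j)|).card ≤ m}
      ≤ ENNReal.ofReal (1 - ρ / 2) ^ J.card * 2 ^ m := by
  set u : ℕ → (ι → ℝ) → ℝ := fun s ω => quadrantSol (g ω) f (s + 1) (k + 1 + 2 * j) with hu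
  have hum : ∀ s, Measurable (u s) := fun s => measurable_quadrantSol f hgm _ _
  set Y : ℕ → (ι → ℝ) → ℝ≥0∞ := fun s ω => if |u s ω| ≤ r then 1 else 2⁻¹ with hYdef
  have hset : ∀ s, MeasurableSet {ω | |u s ω| ≤ r} := fun s =>
    measurableSet_le ((hum s).abs) measurable_const
  have hY : ∀ s, Measurable (Y s) := fun s =>
    Measurable.ite (hset s) measurable_const measurable_const
  have hind : ∀ s ∈ J, ∀ s' < s, ∀ ω x, Y s' (Function.update ω (idx s) x) = Y s' ω := by
    intro s hs s' hs' ω x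
    have : u s' (Function.update ω (idx s) x) = u s' ω :=
      quadrantSol_congr f (s' + 1) (fun s₂ h₂ t => hg1 s hs ω x s₂ t (by simp; omega)) _
    simp only [hYdef, this]
  have hsmall : ∀ s ∈ J, ∀ ω, μ (idx s) {x | |u s (Function.update ω (idx s) x)| ≤ r} ≤
      ENNReal.ofReal (1 - ρ) := by
    intro s hs ω
    rcases Set.eq_empty_or_nonempty {x | |u s (Function.update ω (idx s) x)| ≤ r} with h0 | ⟨x₀, hx₀⟩
    · rw [h0]; simp
    refine le_trans (measure_mono ?_) (measure_clamp_near_le (ν := μ (idx s)) hρ (hsupp _) (hac _)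
      (c := max 0 (min M x₀)) ⟨le_max_left _ _, max_le hM (min_le_left _ _)⟩)
    intro x hx
    obtain ⟨p, rfl⟩ := Nat.exists_eq_add_of_le' (hJ s hs)
    obtain ⟨n, rfl⟩ := Nat.exists_eq_add_of_le' hk
    have hd := quadrantSol_sub (g := g (Function.update ω (idx (p + 1)) x))
      (g' := g (Function.update ω (idx (p + 1)) x₀)) f (p := p) (m := n)
      (fun s' t' h => by rw [hg1 _ hs _ _ _ _ h, hg1 _ hs _ _ _ _ h]) j
    rw [hg2 _ hs, hg2 _ hs] at hd
    have hd' := congrArg abs hd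
    rw [abs_mul, abs_mul, abs_pow, abs_neg, abs_one, one_pow, one_mul, add_sub_add_left_eq_sub]
      at hd'
    have h1 := hlow _ hs (Function.update ω (idx (p + 1)) x)
    have h2 : |quadrantSol (g (Function.update ω (idx (p + 1)) x)) f (p + 2) (n + 2 + 2 * j) -
        quadrantSol (g (Function.update ω (idx (p + 1)) x₀)) f (p + 2) (n + 2 + 2 * j)| ≤ 2 * r := by
      refine (abs_sub _ _).trans ?_
      have := hx.out
      have := hx₀.out
      simp only [hu] at *
      linarith
    have h3 : |max 0 (min M x) - max 0 (min M x₀)| * τ ≤ γ * τ := by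
      refine le_trans (mul_le_mul_of_nonneg_left h1 (abs_nonneg _)) ?_
      linarith
    exact le_of_mul_le_mul_right h3 hτ
  have hq : ∀ s ∈ J, ∀ ω, ∫⁻ x, Y s (Function.update ω (idx s) x) ∂μ (idx s) ≤
      ENNReal.ofReal (1 - ρ / 2) := by
    intro s hs ω
    have hms : MeasurableSet {x | |u s (Function.update ω (idx s) x)| ≤ r} :=
      measurable_update ω (hset s)
    have e : ∀ x, Y s (Function.update ω (idx s) x) = 2⁻¹ + 2⁻¹ *
        {x | |u s (Function.update ω (idx s) x)| ≤ r}.indicator 1 x := fun x => by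
      simp only [hYdef, ite_half_eq, Set.indicator_apply, Set.mem_ofPred_eq, Pi.one_apply]
    simp only [e]
    rw [lintegral_add_left measurable_const, lintegral_const_mul _ (measurable_one.indicator hms),
      lintegral_indicator_one hms, lintegral_const, measure_univ, mul_one]
    calc (2⁻¹ : ℝ≥0∞) + 2⁻¹ * μ (idx s) {x | |u s (Function.update ω (idx s) x)| ≤ r}
        ≤ 2⁻¹ + 2⁻¹ * ENNReal.ofReal (1 - ρ) := by gcongr; exact hsmall s hs ω
      _ = ENNReal.ofReal (1 - ρ / 2) := by
          rw [show (2⁻¹ : ℝ≥0∞) = ENNReal.ofReal 2⁻¹ by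
              rw [ENNReal.ofReal_inv_of_pos two_pos]; simp,
            ← ENNReal.ofReal_mul (by norm_num), ← ENNReal.ofReal_add (by norm_num)
              (mul_nonneg (by norm_num) (by linarith))]
          congr 1; ring
  have hprod := lintegral_pi_prod_le μ idx Y _ hY J hq hind
  have hmark := mul_meas_ge_le_lintegral (μ := Measure.pi μ)
    (Finset.measurable_fun_prod J fun s _ => hY s) ((2⁻¹ : ℝ≥0∞) ^ m)
  have hsub : {ω | (J.filter fun s => r < |u s ω|).card ≤ m} ⊆
      {ω | (2⁻¹ : ℝ≥0∞) ^ m ≤ ∏ s ∈ J, Y s ω} := by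
    intro ω hω
    have e : ∏ s ∈ J, Y s ω = 2⁻¹ ^ (J.filter fun s => r < |u s ω|).card := by
      simp only [hYdef, ← not_lt, ite_not]
      rw [Finset.prod_ite]
      simp
    change _ ≤ ∏ s ∈ J, Y s ω
    rw [e]
    exact pow_le_pow_right_of_le_one' (by simp) hω
  have h2 : (2 : ℝ≥0∞)⁻¹ ^ m * 2 ^ m = 1 := by
    rw [← mul_pow, ENNReal.inv_mul_cancel (by simp) (by simp), one_pow]
  calc _ ≤ Measure.pi μ {ω | (2⁻¹ : ℝ≥0∞) ^ m ≤ ∏ s ∈ J, Y s ω} := measure_mono hsub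
    _ = (2⁻¹ ^ m * Measure.pi μ {ω | (2⁻¹ : ℝ≥0∞) ^ m ≤ ∏ s ∈ J, Y s ω}) * 2 ^ m := by
        rw [mul_right_comm, h2, one_mul]
    _ ≤ _ := by gcongr; exact hmark.trans hprod

/-- The lattice point whose tilted coordinates are `(s + 1, t + 1)`, when `s ≡ t [MOD 2]`. -/
def tiltPt (s t : ℕ) : ℤ × ℤ := (((s : ℤ) + t + 2) / 2, ((s : ℤ) - t) / 2)

lemma tiltPt_add {s t : ℕ} (h : s % 2 = t % 2) : (tiltPt s t).1 + (tiltPt s t).2 = s + 1 := by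
  simp only [tiltPt]; omega

lemma tiltPt_sub {s t : ℕ} (h : s % 2 = t % 2) : (tiltPt s t).1 - (tiltPt s t).2 = t + 1 := by
  simp only [tiltPt]; omega

lemma tiltPt_mem_tRect {s t : ℕ} (h : s % 2 = t % 2) {a₁ a₂ b₁ b₂ : ℤ} :
    tiltPt s t ∈ tRect a₁ a₂ b₁ b₂ ↔ a₁ ≤ s + 1 ∧ (s : ℤ) + 1 ≤ a₂ ∧ b₁ ≤ t + 1 ∧ (t : ℤ) + 1 ≤ b₂ := by
  simp only [tRect, Set.mem_ofPred_eq, tiltPt_add h, tiltPt_sub h]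

lemma exists_tiltPt_eq {a b : ℕ} {n : ℤ × ℤ} (hn : n ∈ tRect 1 a 1 b) :
    ∃ s t : ℕ, s < a ∧ t < b ∧ s % 2 = t % 2 ∧ tiltPt s t = n := by
  obtain ⟨h1, h2, h3, h4⟩ := hn
  refine ⟨(n.1 + n.2 - 1).toNat, (n.1 - n.2 - 1).toNat, by omega, by omega, by omega, ?_⟩
  ext <;> simp only [tiltPt] <;> omega

lemma mem_tRectF {a₁ a₂ b₁ b₂ : ℤ} {n : ℤ × ℤ} :
    n ∈ tRectF a₁ a₂ b₁ b₂ ↔ n ∈ tRect a₁ a₂ b₁ b₂ := by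
  simp only [tRectF, tRect, Finset.mem_filter, Finset.mem_product, Finset.mem_Icc,
    Set.mem_ofPred_eq, and_iff_right_iff_imp]
  intro h
  have := neg_abs_le a₁
  have := le_abs_self a₂
  have := neg_abs_le b₁
  have := le_abs_self b₂
  have := abs_nonneg a₁
  have := abs_nonneg a₂
  have := abs_nonneg b₁
  have := abs_nonneg b₂
  omega

/-- A function on the lattice in tilted coordinates. -/
def tiltFun (ψ : ℤ × ℤ → ℝ) (s t : ℕ) : ℝ := if s % 2 = t % 2 then ψ (tiltPt s t) else 0

/-- The coefficients of the eigenvalue equation in tilted coordinates. -/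
def tiltCoef (V : ℤ × ℤ → ℝ) (E : ℝ) (s t : ℕ) : ℝ :=
  if s % 2 = t % 2 then 4 + V (tiltPt s t) - E else 0

lemma tiltFun_step {V : ℤ × ℤ → ℝ} {E : ℝ} {ψ : ℤ × ℤ → ℝ} {a b : ℕ}
    (h : EigOn V E ψ (tRect 2 ((a : ℤ) - 1) 2 ((b : ℤ) - 1))) {s t : ℕ} (hs : s + 2 < a)
    (ht : t + 2 < b) :
    tiltFun ψ (s + 2) (t + 2) = tiltCoef V E (s + 1) (t + 1) * tiltFun ψ (s + 1) (t + 1)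
      - tiltFun ψ (s + 2) t - tiltFun ψ s (t + 2) - tiltFun ψ s t := by
  by_cases hp : s % 2 = t % 2
  · have hp1 : (s + 1) % 2 = (t + 1) % 2 := by omega
    have hp2 : (s + 2) % 2 = (t + 2) % 2 := by omega
    have hp3 : (s + 2) % 2 = t % 2 := by omega
    have hp4 : s % 2 = (t + 2) % 2 := by omega
    have := h (tiltPt (s + 1) (t + 1)) ((tiltPt_mem_tRect hp1).2 (by omega))
    have e1 : ((tiltPt (s + 1) (t + 1)).1 + 1, (tiltPt (s + 1) (t + 1)).2) =
        tiltPt (s + 2) (t + 2) := by ext <;> simp only [tiltPt] <;> omega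
    have e2 : ((tiltPt (s + 1) (t + 1)).1 - 1, (tiltPt (s + 1) (t + 1)).2) =
        tiltPt s t := by ext <;> simp only [tiltPt] <;> omega
    have e3 : ((tiltPt (s + 1) (t + 1)).1, (tiltPt (s + 1) (t + 1)).2 + 1) =
        tiltPt (s + 2) t := by ext <;> simp only [tiltPt] <;> omega
    have e4 : ((tiltPt (s + 1) (t + 1)).1, (tiltPt (s + 1) (t + 1)).2 - 1) =
        tiltPt s (t + 2) := by ext <;> simp only [tiltPt] <;> omega
    rw [e1, e2, e3, e4] at this
    simp only [tiltFun, tiltCoef, if_pos hp, if_pos hp1, if_pos hp2, if_pos hp3, if_pos hp4]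
    linear_combination -this
  · have hp1 : ¬ (s + 1) % 2 = (t + 1) % 2 := by omega
    simp [tiltFun, hp, hp1]

/-- Boundary data which vanish on the first two lines and equal `φ` on the first two columns. -/
def colData (φ : ℕ → ℝ) (s t : ℕ) : ℝ := if t < 2 then 0 else if s % 2 = t % 2 then φ t else 0

/-- Truncation of a potential to `[0, M]`. -/
def clampPot (M : ℝ) (V : ℤ × ℤ → ℝ) (n : ℤ × ℤ) : ℝ := max 0 (min M (V n))

lemma clampPot_mem {M : ℝ} (hM : 0 ≤ M) (V : ℤ × ℤ → ℝ) (n : ℤ × ℤ) :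
    clampPot M V n ∈ Set.Icc 0 M := ⟨le_max_left _ _, max_le hM (min_le_left _ _)⟩

lemma clampPot_of_mem {M : ℝ} {V : ℤ × ℤ → ℝ} {n : ℤ × ℤ} (h : V n ∈ Set.Icc 0 M) :
    clampPot M V n = V n := by
  rw [clampPot, min_eq_right h.2, max_eq_right h.1]

lemma abs_tiltCoef_le {M E : ℝ} (hM : 0 ≤ M) (hE : E ∈ Set.Icc (-1) (9 + M)) {V : ℤ × ℤ → ℝ}
    {s t : ℕ} (hV : s % 2 = t % 2 → V (tiltPt s t) ∈ Set.Icc 0 M) :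
    |tiltCoef V E s t| ≤ 5 + M := by
  unfold tiltCoef
  split_ifs with h
  · rw [abs_le]
    constructor <;> linarith [(hV h).1, (hV h).2, hE.1, hE.2]
  · rw [abs_zero]; linarith

/-- A solution which is bounded on the first two lines but huge somewhere is, after normalization,
close to one of finitely many solutions with discretized boundary data. -/
lemma exists_net_solution {M E Ebar : ℝ} (hM : 0 ≤ M) {a b : ℕ} (hb : 2 ≤ b)
    (ha : 2 * (2 * (5 + M) + 5) ≤ (a : ℝ)) (hEb : Ebar ∈ Set.Icc (0 : ℝ) (8 + M))
    (hE : |E - Ebar| ≤ ((a : ℝ) ^ (9 * b))⁻¹) {V : ℤ × ℤ → ℝ} {ψ : ℤ × ℤ → ℝ}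
    (hV : ∀ n ∈ tRect 1 a 1 b, V n ∈ Set.Icc 0 M)
    (hψ : EigOn V E ψ (tRect 2 ((a : ℤ) - 1) 2 ((b : ℤ) - 1)))
    (hrow : ∀ n ∈ tRect 1 a 1 2, |ψ n| ≤ 1) {n : ℤ × ℤ} (hn : n ∈ tRect 1 a 1 b)
    (hbig : (a : ℝ) ^ (9 * b) < |ψ n|) :
    ∃ z : ℕ → ℤ, (∀ t < b, |z t| ≤ (a : ℤ) ^ (5 * b)) ∧ (∀ t, b ≤ t → z t = 0) ∧
      (∃ t, 2 ≤ t ∧ t < b ∧ 1 / 2 ≤ |(z t : ℝ) / (a : ℝ) ^ (5 * b)|) ∧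
      ∀ s < a, ∀ t < b, |tiltFun ψ s t| ≤ 1 →
        |quadrantSol (tiltCoef (clampPot M V) Ebar)
          (colData fun t => (z t : ℝ) / (a : ℝ) ^ (5 * b)) s t| ≤ 2 * ((a : ℝ) ^ (3 * b))⁻¹ := by
  set A : ℝ := (a : ℝ) with hA
  have hA2 : 2 ≤ A := by linarith
  have hA1 : 1 ≤ A := by linarith
  have hA0 : 0 < A := by linarith
  have ha1 : 1 ≤ a := Nat.one_le_cast.1 hA1
  have hAA : A * (2 * (5 + M) + 5) ≤ A ^ 2 := by nlinarith
  have hpw : ∀ {i j : ℕ}, i ≤ j → A ^ i ≤ A ^ j := fun h => pow_le_pow_right₀ hA1 h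
  have hp1 : ∀ i : ℕ, 1 ≤ A ^ i := fun i => one_le_pow₀ hA1
  have hp0 : ∀ i : ℕ, 0 < A ^ i := fun i => pow_pos hA0 i
  have h2p : ∀ t < b, 2 * A ^ (2 * t) ≤ A ^ (2 * b) := fun t ht => by
    calc 2 * A ^ (2 * t) ≤ A * A ^ (2 * t) := by gcongr
      _ = A ^ (2 * t + 1) := by ring
      _ ≤ _ := hpw (by omega)
  set w := tiltFun ψ with hw
  have hwrow : ∀ s t, s < a → t < 2 → |w s t| ≤ 1 := by
    intro s t hs ht
    rw [hw, tiltFun]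
    split_ifs with hp
    · exact hrow _ ((tiltPt_mem_tRect hp).2 (by omega))
    · simp
  have hE1 : |E - Ebar| ≤ 1 := hE.trans (inv_le_one_of_one_le₀ (hp1 _))
  have hEi : E ∈ Set.Icc (-1) (9 + M) := by
    have := abs_le.1 hE1
    constructor <;> linarith [hEb.1, hEb.2]
  have hin : ∀ s t, s + 2 < a → t + 2 < b → (s + 1) % 2 = (t + 1) % 2 →
      V (tiltPt (s + 1) (t + 1)) ∈ Set.Icc 0 M := fun s t hs ht hp =>
    hV _ ((tiltPt_mem_tRect hp).2 (by omega))
  -- a priori bound in terms of the data on the first two columns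
  have hapr : ∀ η : ℝ, 1 ≤ η → (∀ t < b, |w (t % 2) t| ≤ η) → ∀ t < b, ∀ s < a,
      |w s t| ≤ η * A ^ (2 * b) := by
    intro η hη hcol t ht s hs
    have := abs_le_of_recurrence (w := w) (g := tiltCoef V E) (h := fun _ _ => 0)
      (β := fun t => η * A ^ (2 * t)) (K := 5 + M) (a := a) (T := b) ha1 (by linarith)
      (fun s t hs ht => by rw [add_zero]; exact tiltFun_step hψ hs ht)
      (fun s t hs ht => abs_tiltCoef_le hM hEi (hin s t hs ht))
      (fun s t _ _ => by rw [abs_zero]; positivity) (fun t => by positivity)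
      (fun t => by
        calc A * (2 * (5 + M) + 5) * (η * A ^ (2 * t)) ≤ A ^ 2 * (η * A ^ (2 * t)) := by gcongr
          _ = η * A ^ (2 * (t + 1)) := by ring)
      (fun s t hs ht => by
        have h1 : η ≤ η * A ^ (2 * t) := le_mul_of_one_le_right (by linarith) (hp1 _)
        by_cases hp : s % 2 = t % 2
        · have : s = t % 2 := by omega
          rw [this]; exact (hcol t ht).trans h1
        · rw [hw, tiltFun, if_neg hp, abs_zero]; linarith)
      (fun s t hs ht _ => by
        have h1 : η ≤ η * A ^ (2 * t) := le_mul_of_one_le_right (by linarith) (hp1 _)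
        linarith [hwrow s t hs ht]) t ht s hs
    refine this.trans ?_
    have := mul_le_mul_of_nonneg_left (h2p t ht) (by linarith : 0 ≤ η)
    linarith
  obtain ⟨t₀, ht₀, hmax⟩ := Finset.exists_max_image (Finset.range b) (fun t => |w (t % 2) t|)
    ⟨0, by simp; omega⟩
  rw [Finset.mem_range] at ht₀
  replace hmax : ∀ t < b, |w (t % 2) t| ≤ |w (t₀ % 2) t₀| := fun t ht =>
    hmax t (Finset.mem_range.2 ht)
  set S := |w (t₀ % 2) t₀| with hS
  have hSbig : A ^ (7 * b) < S := by
    by_contra! hcon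
    obtain ⟨s, t, hs, ht, hp, rfl⟩ := exists_tiltPt_eq hn
    have h1 := hapr (A ^ (7 * b)) (hp1 _) (fun t ht => (hmax t ht).trans hcon) t ht s hs
    rw [← pow_add, show 7 * b + 2 * b = 9 * b by ring, hw, tiltFun, if_pos hp] at h1
    linarith
  have hS1 : 1 < S := (hp1 _).trans_lt hSbig
  have hS0 : 0 < S := by linarith
  have hSinv : S⁻¹ ≤ (A ^ (7 * b))⁻¹ := inv_anti₀ (hp0 _) hSbig.le
  have ht₀2 : 2 ≤ t₀ := by
    by_contra! hlt
    have := hwrow (t₀ % 2) t₀ (by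
      have : (2 : ℝ) ≤ a := hA2
      have : 2 ≤ a := by exact_mod_cast this
      omega) hlt
    linarith
  have hgrow := hapr S hS1.le hmax
  set N : ℝ := A ^ (5 * b) with hN
  have hN0 : 0 < N := hp0 _
  have hN2 : 2 ≤ N := by
    calc (2 : ℝ) ≤ A ^ 1 := by rwa [pow_one]
      _ ≤ _ := hpw (by omega)
  set z : ℕ → ℤ := fun t => if t < b then ⌊w (t % 2) t / S * N⌋ else 0 with hz
  have hzt : ∀ t < b, z t = ⌊w (t % 2) t / S * N⌋ := fun t ht => if_pos ht
  have hz1 : ∀ t < b, |(z t : ℝ) / N - w (t % 2) t / S| ≤ N⁻¹ := by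
    intro t ht
    have h1 := Int.floor_le (w (t % 2) t / S * N)
    have h2 := Int.lt_floor_add_one (w (t % 2) t / S * N)
    have e : (z t : ℝ) / N - w (t % 2) t / S = (z t - w (t % 2) t / S * N) * N⁻¹ := by
      field_simp
    rw [e, abs_mul, abs_of_pos (inv_pos.2 hN0)]
    refine mul_le_of_le_one_left (inv_pos.2 hN0).le (abs_le.2 ⟨?_, ?_⟩) <;> rw [hzt t ht] <;>
      linarith
  have hw1 : ∀ t < b, |w (t % 2) t / S| ≤ 1 := fun t ht => by
    rw [abs_div, abs_of_pos hS0]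
    exact div_le_one_of_le₀ (hmax t ht) hS0.le
  refine ⟨z, ?_, fun t ht => if_neg (by omega), ⟨t₀, ht₀2, ht₀, ?_⟩, ?_⟩
  · intro t ht
    have h1 := abs_le.1 (hw1 t ht)
    have hNc : ((((a : ℤ) ^ (5 * b) : ℤ)) : ℝ) = N := by rw [hN, hA]; push_cast; rfl
    rw [abs_le]
    constructor
    · rw [hzt t ht, Int.le_floor]
      rw [Int.cast_neg, hNc]
      nlinarith
    · rw [hzt t ht, ← Int.cast_le (R := ℝ), hNc]
      refine (Int.floor_le _).trans ?_
      nlinarith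
  · have h1 := hz1 t₀ ht₀
    have h2 : |w (t₀ % 2) t₀ / S| = 1 := by
      rw [abs_div, abs_of_pos hS0, ← hS, div_self hS0.ne']
    have h3 : N⁻¹ ≤ 1 / 2 := by
      rw [one_div]; exact inv_anti₀ two_pos hN2
    have h4 := abs_sub_abs_le_abs_sub (w (t₀ % 2) t₀ / S) ((z t₀ : ℝ) / N)
    rw [abs_sub_comm] at h4
    linarith
  · set u := quadrantSol (tiltCoef (clampPot M V) Ebar) (colData fun t => (z t : ℝ) / N) with hu
    have hinv : ∀ {i j : ℕ}, i ≤ j → (A ^ j)⁻¹ ≤ (A ^ i)⁻¹ := fun h => inv_anti₀ (hp0 _) (hpw h)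
    have hrow' : ∀ s t, s < a → t < 2 → |w s t / S - u s t| ≤ N⁻¹ := by
      intro s t hs ht
      rw [hu, quadrantSol_row _ _ _ ht, colData, if_pos ht, sub_zero, abs_div, abs_of_pos hS0]
      calc |w s t| / S ≤ 1 / S := by gcongr; exact hwrow s t hs ht
        _ = S⁻¹ := one_div S
        _ ≤ _ := hSinv.trans (hinv (by omega))
    have hβN : ∀ t : ℕ, N⁻¹ ≤ N⁻¹ * A ^ (2 * t) := fun t =>
      le_mul_of_one_le_right (inv_pos.2 hN0).le (hp1 _)
    have hdiff : ∀ t < b, ∀ s < a, |w s t / S - u s t| ≤ 2 * (N⁻¹ * A ^ (2 * t)) := by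
      refine abs_le_of_recurrence (w := fun s t => w s t / S - u s t)
        (g := tiltCoef (clampPot M V) Ebar)
        (h := fun s t => (Ebar - E) * (w (s + 1) (t + 1) / S))
        (β := fun t => N⁻¹ * A ^ (2 * t)) (K := 5 + M) ha1 (by linarith) ?_ ?_ ?_ ?_ ?_ ?_ ?_
      · intro s t hs ht
        have e : tiltCoef V E (s + 1) (t + 1) * w (s + 1) (t + 1) =
            (tiltCoef (clampPot M V) Ebar (s + 1) (t + 1) + (Ebar - E)) * w (s + 1) (t + 1) := by
          by_cases hp : (s + 1) % 2 = (t + 1) % 2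
          · rw [tiltCoef, tiltCoef, if_pos hp, if_pos hp, clampPot_of_mem (hin s t hs ht hp)]
            ring
          · rw [hw, tiltFun, if_neg hp]; ring
        have e1 : w (s + 2) (t + 2) = tiltCoef V E (s + 1) (t + 1) * w (s + 1) (t + 1)
          - w (s + 2) t - w s (t + 2) - w s t := tiltFun_step hψ hs ht
        rw [e1, e, hu, quadrantSol_step]
        ring
      · intro s t _ _
        exact abs_tiltCoef_le hM ⟨by linarith [hEb.1], by linarith [hEb.2]⟩
          fun _ => clampPot_mem hM _ _
      · intro s t hs ht
        have h1 := hgrow (t + 1) (by omega) (s + 1) (by omega)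
        refine le_trans ?_ (hβN (t + 1))
        rw [abs_mul, abs_div, abs_of_pos hS0, abs_sub_comm]
        calc |E - Ebar| * (|w (s + 1) (t + 1)| / S)
            ≤ (A ^ (9 * b))⁻¹ * (S * A ^ (2 * b) / S) := by gcongr
          _ = (A ^ (7 * b))⁻¹ := by
              rw [mul_div_cancel_left₀ _ hS0.ne', show 9 * b = 7 * b + 2 * b by ring, pow_add,
                mul_inv, mul_assoc, inv_mul_cancel₀ (hp0 _).ne', mul_one]
          _ ≤ _ := hinv (by omega)
      · intro t; positivity
      · intro t
        calc A * (2 * (5 + M) + 5) * (N⁻¹ * A ^ (2 * t)) ≤ A ^ 2 * (N⁻¹ * A ^ (2 * t)) := by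
              gcongr
          _ = N⁻¹ * A ^ (2 * (t + 1)) := by ring
      · intro s t hs ht
        refine le_trans ?_ (hβN t)
        rcases lt_or_ge t 2 with h2 | h2
        · exact hrow' s t (by
            have : (2 : ℝ) ≤ a := hA2
            have : 2 ≤ a := by exact_mod_cast this
            omega) h2
        rw [hu, quadrantSol_col _ _ hs, colData, if_neg (by omega)]
        by_cases hp : s % 2 = t % 2
        · have : s = t % 2 := by omega
          rw [if_pos hp, this, abs_sub_comm]
          exact hz1 t ht
        · rw [if_neg hp, hw, tiltFun, if_neg hp]
          simpa using hN0.le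
      · intro s t hs ht _
        have := hrow' s t hs ht
        have := hβN t
        have : 0 < N⁻¹ := inv_pos.2 hN0
        linarith
    intro s hs t ht hsm
    have h1 := hdiff t ht s hs
    have h2 : |w s t / S| ≤ (A ^ (3 * b))⁻¹ := by
      rw [abs_div, abs_of_pos hS0]
      calc |w s t| / S ≤ 1 / S := by gcongr
        _ = S⁻¹ := one_div S
        _ ≤ _ := hSinv.trans (hinv (by omega))
    have h3 : 2 * (N⁻¹ * A ^ (2 * t)) ≤ (A ^ (3 * b))⁻¹ := by
      calc 2 * (N⁻¹ * A ^ (2 * t)) = N⁻¹ * (2 * A ^ (2 * t)) := by ring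
        _ ≤ N⁻¹ * A ^ (2 * b) := by gcongr; exact h2p t ht
        _ = (A ^ (3 * b))⁻¹ := by
            rw [hN, show 5 * b = 3 * b + 2 * b by ring, pow_add, mul_inv, mul_assoc,
              inv_mul_cancel₀ (hp0 _).ne', mul_one]
    have h4 := abs_sub_abs_le_abs_sub (u s t) (w s t / S)
    rw [abs_sub_comm] at h4
    linarith

/-- The potential equal to `v` on `F` and to the configuration `W` on `Λ \ F`. -/
def mixPot (F : Set (ℤ × ℤ)) (v : ℤ × ℤ → ℝ) (Λ : Finset (ℤ × ℤ)) (W : Λ → ℝ) (n : ℤ × ℤ) : ℝ :=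
  if n ∈ F then v n else extV Λ W n

lemma measurable_mixPot (F : Set (ℤ × ℤ)) (v : ℤ × ℤ → ℝ) (Λ : Finset (ℤ × ℤ)) (n : ℤ × ℤ) :
    Measurable fun W : Λ → ℝ => mixPot F v Λ W n := by
  unfold mixPot extV
  split_ifs
  · exact measurable_const
  · exact measurable_pi_apply _
  · exact measurable_const

lemma mixPot_update_of_ne (F : Set (ℤ × ℤ)) (v : ℤ × ℤ → ℝ) {Λ : Finset (ℤ × ℤ)} [DecidableEq Λ]
    (W : Λ → ℝ) (i : Λ) (x : ℝ) {n : ℤ × ℤ} (hn : n ≠ i) :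
    mixPot F v Λ (Function.update W i x) n = mixPot F v Λ W n := by
  unfold mixPot extV
  split_ifs with h1 h2
  · rfl
  · rw [Function.update_of_ne]
    exact fun h => hn (congrArg Subtype.val h)
  · rfl

lemma mixPot_update_self {F : Set (ℤ × ℤ)} (v : ℤ × ℤ → ℝ) {Λ : Finset (ℤ × ℤ)} [DecidableEq Λ]
    (W : Λ → ℝ) {i : Λ} (x : ℝ) {n : ℤ × ℤ} (hn : n ∉ F) (hi : (i : ℤ × ℤ) = n) :
    mixPot F v Λ (Function.update W i x) n = x := by
  subst hi
  simp [mixPot, extV, hn]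

/-- The line with parity `s` among the last two lines of a strip of width `b`. -/
def lastLine (b s : ℕ) : ℕ := if s % 2 = (b - 1) % 2 then b - 1 else b - 2

lemma lastLine_parity {b : ℕ} (hb : 2 ≤ b) (s : ℕ) : s % 2 = lastLine b s % 2 := by
  unfold lastLine; split_ifs <;> omega

lemma lastLine_lt {b : ℕ} (hb : 2 ≤ b) (s : ℕ) : lastLine b s < b ∧ b ≤ lastLine b s + 2 := by
  unfold lastLine; split_ifs <;> omega

lemma card_line_inter_le {ε : ℝ} {F : Set (ℤ × ℤ)} {a b : ℕ} (hε : 0 ≤ ε)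
    (hF : SparseIn ε F (tRect 1 a 1 b)) {t : ℕ} (ht : t < b) :
    (((Finset.range a).filter fun s => s % 2 = t % 2 ∧ tiltPt s t ∈ F).card : ℝ) ≤ ε * a := by
  have h1 := (hF (t + 1)).2
  have hsub : tRect 1 a 1 b ∩ {n | n.1 - n.2 = (t : ℤ) + 1} ⊆
      ((Finset.range a).image fun s => tiltPt s t : Finset (ℤ × ℤ)) := by
    rintro n ⟨hn, hnt⟩
    obtain ⟨s, t', hs, ht', hp, rfl⟩ := exists_tiltPt_eq hn
    have : t' = t := by
      have := hnt.out
      rw [tiltPt_sub hp] at this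
      omega
    subst this
    simp only [Finset.coe_image, Set.mem_image, Finset.coe_range, Set.mem_Iio]
    exact ⟨s, hs, rfl⟩
  have hfin : (tRect 1 a 1 b ∩ {n | n.1 - n.2 = (t : ℤ) + 1}).Finite :=
    (Finset.finite_toSet _).subset hsub
  have h2 : ((tRect 1 a 1 b ∩ {n | n.1 - n.2 = (t : ℤ) + 1}).ncard : ℝ) ≤ a := by
    have := Set.ncard_le_ncard hsub (Finset.finite_toSet _)
    rw [Set.ncard_coe_finset] at this
    exact_mod_cast this.trans (Finset.card_image_le.trans (Finset.card_range a).le)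
  have h3 : ((Finset.range a).filter fun s => s % 2 = t % 2 ∧ tiltPt s t ∈ F).card ≤
      (F ∩ tRect 1 a 1 b ∩ {n | n.1 - n.2 = (t : ℤ) + 1}).ncard := by
    rw [← Finset.card_image_of_injOn (f := fun s => tiltPt s t), ← Set.ncard_coe_finset]
    · refine Set.ncard_le_ncard ?_ (hfin.subset fun n hn => ⟨hn.1.2, hn.2⟩)
      intro n hn
      simp only [Finset.coe_image, Set.mem_image, Finset.mem_coe, Finset.mem_filter,
        Finset.mem_range] at hn
      obtain ⟨s, ⟨hs, hp, hsF⟩, rfl⟩ := hn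
      exact ⟨⟨hsF, (tiltPt_mem_tRect hp).2 (by omega)⟩, tiltPt_sub hp⟩
    · intro s hs s' hs' h
      simp only [Finset.coe_filter, Set.mem_ofPred_eq] at hs hs'
      have e1 := tiltPt_add hs.2.1
      have e2 := tiltPt_add hs'.2.1
      simp only at h
      rw [h] at e1
      omega
  calc _ ≤ ((F ∩ tRect 1 a 1 b ∩ {n | n.1 - n.2 = (t : ℤ) + 1}).ncard : ℝ) := by
        exact_mod_cast h3
    _ ≤ _ := h1.trans (by gcongr)

lemma le_card_filter_parity (a k : ℕ) :
    (a - 2) / 2 ≤ ((Finset.Icc 1 (a - 2)).filter fun s => s % 2 = k % 2).card := by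
  rw [← Finset.card_range ((a - 2) / 2)]
  refine Finset.card_le_card_of_injOn (fun i => 2 * i + 2 - k % 2) ?_ ?_
  · intro i hi
    simp only [Finset.coe_range, Set.mem_Iio, Finset.coe_filter, Finset.mem_Icc,
      Set.mem_ofPred_eq] at *
    omega
  · intro i _ j _ h
    simp only at h
    omega

/-- For fixed nonzero boundary data, it is exponentially unlikely that the solution with
coefficients clamped to `[0, M]` is small on most of the last two lines. -/
lemma measure_small_on_lastLine_le (μ : ℤ × ℤ → Measure ℝ) [∀ n, IsProbabilityMeasure (μ n)]
    {M γ ρ ε Ebar : ℝ} (hM : 0 ≤ M) (hρ : 0 ≤ ρ) (hρ1 : ρ ≤ 1)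
    (hsupp : ∀ n, μ n (Set.Icc 0 M) = 1)
    (hac : ∀ n, ∀ t ∈ Set.Icc (0:ℝ) M, ENNReal.ofReal ρ ≤ μ n {s | γ < |s - t|})
    (hEb : Ebar ∈ Set.Icc (0 : ℝ) (8 + M)) {a b : ℕ}
    (ha : 2 * (2 * (5 + M) + 5) ≤ (a : ℝ)) (haγ : 8 ≤ γ * a) (hε : 0 ≤ ε) (hε1 : ε ≤ 1 / 32)
    {F : Set (ℤ × ℤ)} (hF : SparseIn ε F (tRect 1 a 1 b)) (v : ℤ × ℤ → ℝ) (φ : ℕ → ℝ)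
    (hφ : ∃ t, 2 ≤ t ∧ t < b ∧ 1 / 2 ≤ |φ t|) :
    Measure.pi (fun n : ((tRectF 1 a 1 b).filter (· ∉ F) : Finset (ℤ × ℤ)) => μ n.1)
      {W | (((Finset.range a).filter fun s => tiltPt s (lastLine b s) ∉ F ∧
        2 * ((a : ℝ) ^ (3 * b))⁻¹ <
          |quadrantSol (tiltCoef (clampPot M (mixPot F v _ W)) Ebar) (colData φ) s
            (lastLine b s)|).card : ℝ) ≤ ε * a} ≤
      ENNReal.ofReal (Real.exp (-(ρ / 8 - ε) * a)) := by
  set A : ℝ := (a : ℝ) with hA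
  set Λ : Finset (ℤ × ℤ) := (tRectF 1 a 1 b).filter (· ∉ F) with hΛ
  set g : (Λ → ℝ) → ℕ → ℕ → ℝ := fun W => tiltCoef (clampPot M (mixPot F v Λ W)) Ebar with hg
  have hA30 : 30 ≤ A := by linarith
  have hA1 : 1 ≤ A := by linarith
  have hA0 : 0 < A := by linarith
  have ha30 : 30 ≤ a := by
    have : (30 : ℝ) ≤ a := hA30
    exact_mod_cast this
  have hp0 : ∀ i : ℕ, 0 < A ^ i := fun i => pow_pos hA0 i
  have hpw : ∀ {i j : ℕ}, i ≤ j → A ^ i ≤ A ^ j := fun h => pow_le_pow_right₀ hA1 h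
  obtain ⟨t₁, ht₁, ht₁b, hφt₁⟩ := hφ
  have hb : 2 ≤ b := by omega
  set r : ℝ := 2 * (A ^ (3 * b))⁻¹ with hr
  set β : ℕ → ℝ := fun t => (A ^ (2 * b))⁻¹ * A ^ (2 * t) with hβ
  have hβ0 : ∀ t, 0 ≤ β t := fun t => by positivity
  have hβs : ∀ t, 2 * (a * (2 * (5 + M) + 5)) * β t ≤ β (t + 1) := fun t => by
    have h1 : 2 * (A * (2 * (5 + M) + 5)) ≤ A ^ 2 := by nlinarith
    calc 2 * (A * (2 * (5 + M) + 5)) * β t ≤ A ^ 2 * β t := by gcongr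
      _ = β (t + 1) := by simp only [hβ]; ring
  -- the first line on which the boundary data exceed the threshold
  have hex : ∃ t, 2 ≤ t ∧ β t ≤ |φ t| := by
    refine ⟨t₁, ht₁, le_trans ?_ hφt₁⟩
    have h2 : A ^ (2 * t₁) * 2 ≤ A ^ (2 * b) := by
      calc A ^ (2 * t₁) * 2 ≤ A ^ (2 * t₁) * A := by gcongr; linarith
        _ = A ^ (2 * t₁ + 1) := by ring
        _ ≤ _ := hpw (by omega)
    simp only [hβ]
    rw [inv_mul_le_iff₀ (hp0 _)]
    linarith
  set k := Nat.find hex with hk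
  obtain ⟨hk2, hkβ⟩ := Nat.find_spec hex
  rw [← hk] at hk2 hkβ
  have hkmin : ∀ t, 2 ≤ t → t < k → |φ t| < β t := fun t h2 ht => by
    have := Nat.find_min hex ht
    push Not at this
    exact this h2
  have hkb : k < b := by
    by_contra! hcon
    have h1 := hkmin t₁ ht₁ (by omega)
    have h2 : β t₁ ≤ 1 / 2 := by
      have h2 : A ^ (2 * t₁) * 2 ≤ A ^ (2 * b) := by
        calc A ^ (2 * t₁) * 2 ≤ A ^ (2 * t₁) * A := by gcongr; linarith
          _ = A ^ (2 * t₁ + 1) := by ring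
          _ ≤ _ := hpw (by omega)
      simp only [hβ]
      rw [inv_mul_le_iff₀ (hp0 _)]
      linarith
    linarith
  set τ : ℝ := (A ^ (2 * b))⁻¹ / 2 with hτ
  have hτ0 : 0 < τ := by positivity
  have hlow : ∀ W, ∀ s < a, s % 2 = k % 2 → τ ≤ |quadrantSol (g W) (colData φ) s k| := by
    intro W s hs hp
    have h1 := half_le_abs_quadrantSol (g := g W) (f := colData φ) (β := β) (K := 5 + M)
      (a := a) (k := k) (by omega) (by linarith)
      (fun s t => abs_tiltCoef_le hM ⟨by linarith [hEb.1], by linarith [hEb.2]⟩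
          fun _ => clampPot_mem hM _ _) hβ0 hβs
      (fun s t ht => by rw [colData, if_pos ht]) hk2
      (fun s t hs ht => by
        rw [colData]
        split_ifs with h2 h3
        · rw [abs_zero]; exact hβ0 t
        · exact (hkmin t (by omega) ht).le
        · rw [abs_zero]; exact hβ0 t) hs
      (by rwa [colData, if_neg (by omega), if_pos (by omega)])
    refine le_trans ?_ h1
    have : (1 : ℝ) ≤ A ^ (2 * k) := one_le_pow₀ hA1
    have := le_mul_of_one_le_right (inv_pos.2 (hp0 (2 * b))).le this
    simp only [hτ, hβ]
    linarith
  have hAb : A ≤ A ^ b := by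
    calc A = A ^ 1 := (pow_one A).symm
      _ ≤ _ := hpw (by omega)
  have h3b : (A ^ (3 * b))⁻¹ = (A ^ (2 * b))⁻¹ * (A ^ b)⁻¹ := by
    rw [← mul_inv, ← pow_add]; congr 2; ring
  have hinvA : (A ^ b)⁻¹ ≤ A⁻¹ := inv_anti₀ hA0 hAb
  have hX : 0 < (A ^ (2 * b))⁻¹ := inv_pos.2 (hp0 _)
  have hrτ : r < τ := by
    have h1 : A⁻¹ ≤ 30⁻¹ := inv_anti₀ (by norm_num) hA30
    have : (A ^ (2 * b))⁻¹ * (A ^ b)⁻¹ ≤ (A ^ (2 * b))⁻¹ * 30⁻¹ :=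
      mul_le_mul_of_nonneg_left (hinvA.trans h1) hX.le
    rw [hr, hτ, h3b]
    linarith
  have hrγ : 2 * r ≤ γ * τ := by
    have h1 : A⁻¹ * 8 ≤ γ := by
      rw [inv_mul_le_iff₀ hA0]; linarith
    have h2 : (A ^ (2 * b))⁻¹ * ((A ^ b)⁻¹ * 8) ≤ (A ^ (2 * b))⁻¹ * γ := by
      gcongr
      exact le_trans (by gcongr) h1
    rw [hr, hτ, h3b]
    linarith
  have hcount := le_card_filter_parity a k
  have hcountR : (A - 3) / 2 ≤ ((Finset.Icc 1 (a - 2)).filter fun s => s % 2 = k % 2).card := by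
    have h1 : a ≤ 2 * ((Finset.Icc 1 (a - 2)).filter fun s => s % 2 = k % 2).card + 3 := by omega
    have h2 : A ≤ 2 * ((Finset.Icc 1 (a - 2)).filter fun s => s % 2 = k % 2).card + 3 := by
      rw [hA]; exact_mod_cast h1
    linarith
  have hFk := card_line_inter_le hε hF hkb
  rcases Nat.lt_or_ge k (b - 1) with hlt | hge
  · set j := (b - 2 - k) / 2 with hj
    have hlast : ∀ s, s % 2 = k % 2 → lastLine b (s + 1) = k + 1 + 2 * j := fun s hs => by
      unfold lastLine; split_ifs <;> omega
    set q := k + 1 + 2 * j with hq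
    have hqb : q < b := by omega
    set J : Finset ℕ := (Finset.Icc 1 (a - 2)).filter fun s =>
      s % 2 = k % 2 ∧ tiltPt s k ∉ F ∧ tiltPt (s + 1) q ∉ F with hJ
    have hJmem : ∀ s ∈ J, 1 ≤ s ∧ s + 2 ≤ a ∧ s % 2 = k % 2 ∧ tiltPt s k ∉ F ∧
        tiltPt (s + 1) q ∉ F := fun s hs => by
      simp only [hJ, Finset.mem_filter, Finset.mem_Icc] at hs
      exact ⟨hs.1.1, by omega, hs.2⟩
    have hJΛ : ∀ s ∈ J, tiltPt s k ∈ Λ := fun s hs => by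
      obtain ⟨h1, h2, h3, h4, _⟩ := hJmem s hs
      rw [hΛ, Finset.mem_filter, mem_tRectF, tiltPt_mem_tRect h3]
      exact ⟨by omega, h4⟩
    have hJcard : A / 4 ≤ J.card := by
      have hFq := card_line_inter_le hε hF hqb
      have h1 : ((Finset.Icc 1 (a - 2)).filter fun s => s % 2 = k % 2).card ≤ J.card +
          (((Finset.range a).filter fun s => s % 2 = k % 2 ∧ tiltPt s k ∈ F).card +
          ((Finset.range a).filter fun s => s % 2 = q % 2 ∧ tiltPt s q ∈ F).card) := by
        have h2 : ((Finset.Icc 1 (a - 2)).filter fun s => s % 2 = k % 2) ⊆ J ∪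
            (((Finset.range a).filter fun s => s % 2 = k % 2 ∧ tiltPt s k ∈ F) ∪
            ((Finset.range a).filter fun s => s % 2 = q % 2 ∧ tiltPt s q ∈ F).image
              fun s => s - 1) := by
          intro s hs
          simp only [Finset.mem_union, Finset.mem_image, Finset.mem_filter, Finset.mem_Icc, hJ,
            Finset.mem_range] at hs ⊢
          by_cases h3 : tiltPt s k ∈ F
          · exact Or.inr (Or.inl ⟨by omega, hs.2, h3⟩)
          by_cases h4 : tiltPt (s + 1) q ∈ F
          · exact Or.inr (Or.inr ⟨s + 1, ⟨by omega, by omega, h4⟩, by omega⟩)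
          exact Or.inl ⟨hs.1, hs.2, h3, h4⟩
        refine (Finset.card_le_card h2).trans ((Finset.card_union_le _ _).trans ?_)
        refine Nat.add_le_add_left ((Finset.card_union_le _ _).trans ?_) _
        exact Nat.add_le_add_left Finset.card_image_le _
      have h2 : (((Finset.Icc 1 (a - 2)).filter fun s => s % 2 = k % 2).card : ℝ) ≤ J.card +
          (((Finset.range a).filter fun s => s % 2 = k % 2 ∧ tiltPt s k ∈ F).card +
          ((Finset.range a).filter fun s => s % 2 = q % 2 ∧ tiltPt s q ∈ F).card) := by
        exact_mod_cast h1
      have h3 : ε * A ≤ 1 / 32 * A := by gcongr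
      linarith
    rcases J.eq_empty_or_nonempty with hJ0 | ⟨s₀, hs₀⟩
    · rw [hJ0] at hJcard
      simp at hJcard
      linarith
    set idx : ℕ → Λ := fun s => if h : s ∈ J then ⟨tiltPt s k, hJΛ s h⟩ else
      ⟨tiltPt s₀ k, hJΛ s₀ hs₀⟩ with hidx
    have hidxJ : ∀ s (h : s ∈ J), idx s = ⟨tiltPt s k, hJΛ s h⟩ := fun s h => dif_pos h
    set m := ⌊ε * A⌋₊ with hm
    have hεA : 0 ≤ ε * A := by positivity
    have hgm : ∀ s t, Measurable fun W => g W s t := by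
      intro s t
      simp only [hg, tiltCoef, clampPot]
      split_ifs
      · exact ((measurable_const.add (measurable_const.max (measurable_const.min
          (measurable_mixPot F v Λ _)))).sub measurable_const)
      · exact measurable_const
    have hmain := measure_few_large_le (fun n : Λ => μ n.1) (r := r) hM hρ hρ1 (fun n => hsupp n.1)
      (fun n => hac n.1) g (colData φ) hgm (k := k) (by omega) j J (fun s hs => (hJmem s hs).1) idx
      (4 - Ebar) (by
        intro s hs W x s' t' hne
        obtain ⟨_, _, hp, _, _⟩ := hJmem s hs
        simp only [hg, tiltCoef, clampPot]
        split_ifs with hp'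
        · rw [mixPot_update_of_ne]
          rw [hidxJ s hs]
          intro he
          have e1 := tiltPt_add hp
          have e2 := tiltPt_add hp'
          have e3 := tiltPt_sub hp
          have e4 := tiltPt_sub hp'
          simp only at he
          rw [he] at e2 e4
          exact hne (Prod.ext (by simp; omega) (by simp; omega))
        · rfl)
      (by
        intro s hs W x
        obtain ⟨_, _, hp, hF', _⟩ := hJmem s hs
        have key : ∀ _ : DecidableEq Λ,
            mixPot F v Λ (Function.update W (idx s) x) (tiltPt s k) = x := fun _ =>
          mixPot_update_self v W x hF' (by rw [hidxJ s hs])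
        simp only [hg, tiltCoef, clampPot, if_pos hp, key]
        ring)
      hτ0 (fun s hs W => hlow W s (by have := hJmem s hs; omega) (hJmem s hs).2.2.1) hrγ m
    refine (measure_mono ?_).trans (hmain.trans ?_)
    · intro W hW
      have hW' := Nat.le_floor hW.out
      refine le_trans ?_ hW'
      refine Finset.card_le_card_of_injOn (fun s => s + 1) ?_ (by intro x _ y _ h; simpa using h)
      intro s hs
      simp only [Finset.coe_filter, Set.mem_ofPred_eq, Finset.mem_range] at hs ⊢
      obtain ⟨h1, h2, h3, h4, h5⟩ := hJmem s hs.1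
      rw [hlast s h3]
      exact ⟨by omega, h5, hs.2⟩
    · rw [← ENNReal.ofReal_pow (by linarith), show (2 : ℝ≥0∞) = ENNReal.ofReal 2 by simp,
        ← ENNReal.ofReal_pow (by norm_num), ← ENNReal.ofReal_mul (pow_nonneg (by linarith) _)]
      refine ENNReal.ofReal_le_ofReal ?_
      have h1 : 1 - ρ / 2 ≤ Real.exp (-(ρ / 2)) := by
        have := Real.add_one_le_exp (-(ρ / 2)); linarith
      have h2 : (2 : ℝ) ≤ Real.exp 1 := by
        have := Real.add_one_le_exp (1 : ℝ); linarith
      calc (1 - ρ / 2) ^ J.card * 2 ^ m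
          ≤ Real.exp (-(ρ / 2)) ^ J.card * Real.exp 1 ^ m := by
            gcongr
            linarith
        _ = Real.exp (J.card * (-(ρ / 2)) + m * 1) := by
            rw [← Real.exp_nat_mul, ← Real.exp_nat_mul, ← Real.exp_add]
        _ ≤ _ := by
            apply Real.exp_le_exp.2
            have h3 : (m : ℝ) ≤ ε * A := Nat.floor_le hεA
            have h4 : A / 4 * (ρ / 2) ≤ J.card * (ρ / 2) := by gcongr
            linarith
  · have hkb1 : k = b - 1 := by omega
    refine le_trans (le_of_eq ?_) (zero_le)
    rw [← nonpos_iff_eq_zero, ← measure_empty (μ := Measure.pi fun n : Λ => μ n.1)]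
    refine measure_mono ?_
    intro W hW
    have hW1 := hW.out
    have h1 : ((Finset.Icc 1 (a - 2)).filter fun s => s % 2 = k % 2) ⊆
        ((Finset.range a).filter fun s => tiltPt s (lastLine b s) ∉ F ∧
          r < |quadrantSol (g W) (colData φ) s (lastLine b s)|) ∪
        ((Finset.range a).filter fun s => s % 2 = k % 2 ∧ tiltPt s k ∈ F) := by
      intro s hs
      simp only [Finset.mem_union, Finset.mem_filter, Finset.mem_Icc, Finset.mem_range] at hs ⊢
      have hl : lastLine b s = k := by unfold lastLine; split_ifs <;> omega
      rw [hl]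
      by_cases h3 : tiltPt s k ∈ F
      · exact Or.inr ⟨by omega, hs.2, h3⟩
      · exact Or.inl ⟨by omega, h3, hrτ.trans_le (hlow W s (by omega) hs.2)⟩
    have h2 := (Finset.card_le_card h1).trans (Finset.card_union_le _ _)
    have h3 : (((Finset.Icc 1 (a - 2)).filter fun s => s % 2 = k % 2).card : ℝ) ≤
        ((Finset.range a).filter fun s => tiltPt s (lastLine b s) ∉ F ∧
          r < |quadrantSol (g W) (colData φ) s (lastLine b s)|).card +
        ((Finset.range a).filter fun s => s % 2 = k % 2 ∧ tiltPt s k ∈ F).card := by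
      exact_mod_cast h2
    have h4 : ε * A ≤ 1 / 32 * A := by gcongr
    linarith

lemma one_sub_le_measure {Ω : Type*} [MeasurableSpace Ω] (P : Measure Ω) [IsProbabilityMeasure P]
    {S : Set Ω} {p : ℝ≥0∞} (h : P Sᶜ ≤ p) : 1 - p ≤ P S := by
  rw [tsub_le_iff_right]
  calc 1 = P (S ∪ Sᶜ) := by rw [Set.union_compl_self, measure_univ]
    _ ≤ P S + P Sᶜ := measure_union_le _ _
    _ ≤ P S + p := by gcongr

lemma measure_pi_exists_notMem_eq_zero {ι : Type*} [Fintype ι] (ν : ι → Measure ℝ)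
    [∀ i, IsProbabilityMeasure (ν i)] {I : Set ℝ} (hI : MeasurableSet I)
    (hν : ∀ i, ν i I = 1) : Measure.pi ν {W | ∃ i, W i ∉ I} = 0 := by
  have h : {W : ι → ℝ | ∃ i, W i ∉ I} = ⋃ i, Function.eval i ⁻¹' Iᶜ := by
    ext W; simp
  rw [h, measure_iUnion_null_iff]
  intro i
  rw [(measurePreserving_eval ν i).measure_preimage hI.compl.nullMeasurableSet,
    prob_compl_eq_zero_iff hI, hν]

/-- If a function is at most `1` on most of the free sites of the last two lines, then few free
sites on these lines carry a value larger than `1`. -/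
lemma card_large_lastLine_le {ε : ℝ} (hε : 0 ≤ ε) {F : Set (ℤ × ℤ)} {a b : ℕ} (hb : 2 ≤ b)
    {ψ : ℤ × ℤ → ℝ}
    (h : (1 - ε) * ((((tRectF 1 a ((b : ℤ) - 1) b).filter (· ∉ F)).card : ℝ)) ≤
      ((((tRectF 1 a ((b : ℤ) - 1) b).filter (· ∉ F)).filter (fun n => |ψ n| ≤ 1)).card : ℝ)) :
    (((Finset.range a).filter fun s => tiltPt s (lastLine b s) ∉ F ∧
      1 < |tiltFun ψ s (lastLine b s)|).card : ℝ) ≤ ε * a := by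
  set T := (tRectF 1 a ((b : ℤ) - 1) b).filter (· ∉ F) with hT
  have hTa : T.card ≤ a := by
    have h1 : T.card ≤ (Finset.Icc (1 : ℤ) a).card := by
      refine Finset.card_le_card_of_injOn (fun n => n.1 + n.2) ?_ ?_
      · intro n hn
        simp only [hT, Finset.coe_filter, Set.mem_ofPred_eq, mem_tRectF] at hn
        simp only [Finset.coe_Icc, Set.mem_Icc]
        exact ⟨hn.1.1, hn.1.2.1⟩
      · intro n hn n' hn' he
        simp only [hT, Finset.coe_filter, Set.mem_ofPred_eq, mem_tRectF] at hn hn'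
        obtain ⟨⟨_, _, h1, h2⟩, _⟩ := hn
        obtain ⟨⟨_, _, h3, h4⟩, _⟩ := hn'
        simp only at he
        ext <;> omega
    simpa using h1
  have hcard : ((Finset.range a).filter fun s => tiltPt s (lastLine b s) ∉ F ∧
      1 < |tiltFun ψ s (lastLine b s)|).card ≤ (T.filter fun n => ¬ |ψ n| ≤ 1).card := by
    refine Finset.card_le_card_of_injOn (fun s => tiltPt s (lastLine b s)) ?_ ?_
    · intro s hs
      simp only [Finset.coe_filter, Set.mem_ofPred_eq, Finset.mem_range, hT, Finset.mem_filter,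
        mem_tRectF] at hs ⊢
      have hp := lastLine_parity hb s
      have hl := lastLine_lt hb s
      obtain ⟨h1, h2, h3⟩ := hs
      rw [tiltFun, if_pos hp] at h3
      exact ⟨⟨(tiltPt_mem_tRect hp).2 (by omega), h2⟩, not_le.2 h3⟩
    · intro s _ s' _ he
      have e1 := tiltPt_add (lastLine_parity hb s)
      have e2 := tiltPt_add (lastLine_parity hb s')
      simp only at he
      rw [he] at e1
      omega
  have hsum := Finset.card_filter_add_card_filter_not (s := T) (fun n => |ψ n| ≤ 1)
  have hsumR : ((T.filter fun n => |ψ n| ≤ 1).card : ℝ) + (T.filter fun n => ¬ |ψ n| ≤ 1).card =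
      T.card := by exact_mod_cast hsum
  have hcardR : (((Finset.range a).filter fun s => tiltPt s (lastLine b s) ∉ F ∧
      1 < |tiltFun ψ s (lastLine b s)|).card : ℝ) ≤ (T.filter fun n => ¬ |ψ n| ≤ 1).card := by
    exact_mod_cast hcard
  have hTaR : (T.card : ℝ) ≤ a := by exact_mod_cast hTa
  have := mul_le_mul_of_nonneg_left hTaR hε
  linarith

/-- The integer vectors of length `b` with entries bounded by `N`, extended by zero. -/
def netData (b : ℕ) (N : ℤ) : Finset (ℕ → ℤ) :=
  (Fintype.piFinset fun _ : Fin b => Finset.Icc (-N) N).image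
    fun z t => if h : t < b then z ⟨t, h⟩ else 0

lemma mem_netData {b : ℕ} {N : ℤ} {z : ℕ → ℤ} (h1 : ∀ t < b, |z t| ≤ N)
    (h2 : ∀ t, b ≤ t → z t = 0) : z ∈ netData b N := by
  rw [netData, Finset.mem_image]
  refine ⟨fun i => z i, ?_, ?_⟩
  · rw [Fintype.mem_piFinset]
    exact fun i => Finset.mem_Icc.2 (abs_le.1 (h1 i i.2))
  · ext t
    split_ifs with h
    · rfl
    · exact (h2 t (not_lt.1 h)).symm

lemma card_netData_le {b : ℕ} {N : ℤ} (hN : 0 ≤ N) :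
    ((netData b N).card : ℝ) ≤ (2 * (N : ℝ) + 1) ^ b := by
  have h1 : (netData b N).card ≤ (N + 1 - -N).toNat ^ b := by
    refine Finset.card_image_le.trans ?_
    rw [Fintype.card_piFinset_const, Int.card_Icc]
  have h2 : ((N + 1 - -N).toNat : ℝ) = 2 * (N : ℝ) + 1 := by
    have : (((N + 1 - -N).toNat : ℤ) : ℝ) = ((2 * N + 1 : ℤ) : ℝ) := by
      congr 1; omega
    push_cast at this
    exact this
  rw [← h2]
  exact_mod_cast h1

lemma card_netData_pow_le {a b : ℕ} (ha : 3 ≤ (a : ℝ)) (hb : b ≠ 0) :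
    ((netData b ((a : ℤ) ^ (5 * b))).card : ℝ) ≤ Real.exp (6 * ((b : ℝ) ^ 2 * Real.log a)) := by
  have ha0 : 0 < (a : ℝ) := by linarith
  have h1 : 1 ≤ (a : ℝ) ^ (5 * b) := one_le_pow₀ (by linarith)
  have h2 : (a : ℝ) ≤ (a : ℝ) ^ b := le_self_pow₀ (by linarith) hb
  calc ((netData b ((a : ℤ) ^ (5 * b))).card : ℝ) ≤ (2 * (a : ℝ) ^ (5 * b) + 1) ^ b := by
        have := card_netData_le (b := b) (N := (a : ℤ) ^ (5 * b)) (by positivity)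
        push_cast at this
        exact this
    _ ≤ ((a : ℝ) ^ (6 * b)) ^ b := by
        have h3 : (a : ℝ) ^ (6 * b) = (a : ℝ) ^ b * (a : ℝ) ^ (5 * b) := by
          rw [← pow_add]; congr 1; ring
        refine pow_le_pow_left₀ (by positivity) ?_ _
        rw [h3]
        nlinarith
    _ = Real.exp (6 * ((b : ℝ) ^ 2 * Real.log a)) := by
        rw [← pow_mul, ← Real.exp_log (pow_pos ha0 _), Real.log_pow]
        congr 1
        push_cast
        ring

/-- unique continuation key lemma on tilted rectangles. For
independent site measures `μ n` supported in `[0,M]` and uniformly anti-concentrated,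
there are `α > 1 > ε > 0` such that for every `Ē ∈ [0,8+M]`, integers `a, b ≥ 2` with
`a ≥ α·b²·log a ≥ α²`, every `F` which is `ε`-sparse in `R = R_{[1,a],[1,b]}` and every
`v : F → [0,M]`, with probability at least `1 − e^{−εa}` over the configuration on `R\F`
the following holds: whenever `|E − Ē| ≤ e^{−α·b·log a}`, `Hψ = Eψ` in `R°`, `|ψ| ≤ 1`
on `R_{[1,a],[1,2]}`, and `|ψ| ≤ 1` on a `1−ε` fraction of `R_{[1,a],[b−1,b]}\F`, then
`|ψ| ≤ e^{α·b·log a}` on `R`. -/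
theorem stmt_14 (M γ₀ ρ : ℝ) (hM : 0 < M) (hγ : 0 < γ₀) (hρ : 0 < ρ)
    (μ : ℤ × ℤ → Measure ℝ) [∀ n, IsProbabilityMeasure (μ n)]
    (hsupp : ∀ n, μ n (Set.Icc 0 M) = 1)
    (hac : ∀ n, ∀ t ∈ Set.Icc (0:ℝ) M, ENNReal.ofReal ρ ≤ μ n {s | γ₀ / 2 < |s - t|}) :
    ∃ α ε : ℝ, 1 < α ∧ 0 < ε ∧ ε < 1 ∧
      ∀ Ebar ∈ Set.Icc (0:ℝ) (8 + M), ∀ a b : ℕ, 2 ≤ a → 2 ≤ b →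
      α * (b : ℝ) ^ 2 * Real.log a ≤ (a : ℝ) →
      α ^ 2 ≤ α * (b : ℝ) ^ 2 * Real.log a →
      ∀ F : Set (ℤ × ℤ), SparseIn ε F (tRect 1 a 1 b) →
      ∀ v : ℤ × ℤ → ℝ, (∀ n ∈ F, v n ∈ Set.Icc (0:ℝ) M) →
        1 - ENNReal.ofReal (Real.exp (-ε * a)) ≤
          Measure.pi (fun n : ((tRectF 1 a 1 b).filter (· ∉ F) : Finset (ℤ × ℤ)) => μ n.1)
            {W | ∀ (E : ℝ) (ψ : ℤ × ℤ → ℝ),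
              |E - Ebar| ≤ Real.exp (-α * b * Real.log a) →
              EigOn (fun n => if n ∈ F then v n
                  else extV ((tRectF 1 a 1 b).filter (· ∉ F)) W n) E ψ
                (tRect 2 ((a : ℤ) - 1) 2 ((b : ℤ) - 1)) →
              (∀ n ∈ tRect 1 a 1 2, |ψ n| ≤ 1) →
              ((1 - ε) * ((((tRectF 1 a ((b : ℤ) - 1) b).filter (· ∉ F)).card : ℝ)) ≤
                ((((tRectF 1 a ((b : ℤ) - 1) b).filter (· ∉ F)).filter
                    (fun n => |ψ n| ≤ 1)).card : ℝ)) →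
              ∀ n ∈ tRect 1 a 1 b, |ψ n| ≤ Real.exp (α * b * Real.log a)} := by
  have hρ1 : ρ ≤ 1 := by
    have := (hac 0 0 ⟨le_rfl, hM.le⟩).trans prob_le_one
    rwa [ENNReal.ofReal_le_one] at this
  set α : ℝ := max 9 (max (96 / ρ) (max (2 * (2 * (5 + M) + 5)) (16 / γ₀))) with hα
  have hα9 : 9 ≤ α := le_max_left _ _
  have hαρ : 96 / ρ ≤ α := (le_max_left _ _).trans (le_max_right _ _)
  have hαM : 2 * (2 * (5 + M) + 5) ≤ α :=
    (le_max_left _ _).trans ((le_max_right _ _).trans (le_max_right _ _))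
  have hαγ : 16 / γ₀ ≤ α :=
    (le_max_right _ _).trans ((le_max_right _ _).trans (le_max_right _ _))
  refine ⟨α, ρ / 32, by linarith, by positivity, by linarith, ?_⟩
  intro Ebar hEb a b _ hb hab hαab F hF v hv
  have hαa : α ≤ a := by nlinarith
  have ha0 : 0 < (a : ℝ) := by linarith
  have hlog : 0 ≤ Real.log a := Real.log_nonneg (by linarith)
  have haM : 2 * (2 * (5 + M) + 5) ≤ (a : ℝ) := hαM.trans hαa
  have haγ : 8 ≤ γ₀ / 2 * a := by
    have := (div_le_iff₀ hγ).1 (hαγ.trans hαa)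
    linarith
  have hpow : (a : ℝ) ^ (9 * b) ≤ Real.exp (α * b * Real.log a) := by
    rw [← Real.exp_log (pow_pos ha0 _), Real.log_pow]
    push_cast
    gcongr
  have hpow' : Real.exp (-α * b * Real.log a) ≤ ((a : ℝ) ^ (9 * b))⁻¹ := by
    rw [neg_mul, neg_mul, Real.exp_neg]
    exact inv_anti₀ (pow_pos ha0 _) hpow
  have hexp : 6 * ((b : ℝ) ^ 2 * Real.log a) + -(ρ / 8 - ρ / 32) * a ≤ -(ρ / 32) * a := by
    have h1 : 96 ≤ α * ρ := (div_le_iff₀ hρ).1 hαρ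
    have h2 : 96 * ((b : ℝ) ^ 2 * Real.log a) ≤ ρ * a := by
      calc 96 * ((b : ℝ) ^ 2 * Real.log a) ≤ α * ρ * ((b : ℝ) ^ 2 * Real.log a) := by gcongr
        _ = ρ * (α * (b : ℝ) ^ 2 * Real.log a) := by ring
        _ ≤ ρ * a := by gcongr
    linarith
  set Λ : Finset (ℤ × ℤ) := (tRectF 1 a 1 b).filter (· ∉ F) with hΛ
  set D : Finset (ℕ → ℤ) := (netData b ((a : ℤ) ^ (5 * b))).filter fun z =>
    ∃ t, 2 ≤ t ∧ t < b ∧ 1 / 2 ≤ |(z t : ℝ) / (a : ℝ) ^ (5 * b)| with hD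
  set bad : (ℕ → ℤ) → Set (Λ → ℝ) := fun z =>
    {W | (((Finset.range a).filter fun s => tiltPt s (lastLine b s) ∉ F ∧
      2 * ((a : ℝ) ^ (3 * b))⁻¹ < |quadrantSol (tiltCoef (clampPot M (mixPot F v Λ W)) Ebar)
        (colData fun t => (z t : ℝ) / (a : ℝ) ^ (5 * b)) s (lastLine b s)|).card : ℝ) ≤
          ρ / 32 * a} with hbad
  have hbadle : ∀ z ∈ D, Measure.pi (fun n : Λ => μ n.1) (bad z) ≤
      ENNReal.ofReal (Real.exp (-(ρ / 8 - ρ / 32) * a)) := fun z hz =>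
    measure_small_on_lastLine_le μ hM.le hρ.le hρ1 hsupp hac hEb haM haγ (by positivity)
      (by linarith) hF v _ (Finset.mem_filter.1 hz).2
  have hDcard : (D.card : ℝ) ≤ Real.exp (6 * ((b : ℝ) ^ 2 * Real.log a)) := by
    refine le_trans ?_ (card_netData_pow_le (by linarith) (by omega))
    exact_mod_cast Finset.card_filter_le _ _
  refine one_sub_le_measure _ ((measure_mono (t := {W : Λ → ℝ | ∃ n, W n ∉ Set.Icc 0 M} ∪
    ⋃ z ∈ D, bad z) ?_).trans ((measure_union_le _ _).trans ?_))
  · intro W hW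
    by_contra! hgood
    refine hW fun E ψ hE hψ hrow hfew n hn => ?_
    rw [Set.mem_union, not_or] at hgood
    obtain ⟨hsup, hgood⟩ := hgood
    have hsup' : ∀ n, W n ∈ Set.Icc 0 M := by
      simpa only [Set.mem_ofPred_eq, not_exists, not_not] using hsup
    have hV : ∀ n ∈ tRect 1 a 1 b, mixPot F v Λ W n ∈ Set.Icc 0 M := by
      intro n hn
      unfold mixPot extV
      split_ifs with h1 h2
      · exact hv n h1
      · exact hsup' _
      · exact ⟨le_rfl, hM.le⟩
    by_contra! hbig
    obtain ⟨z, hz1, hz2, hz3, hz4⟩ := exists_net_solution hM.le hb haM hEb (hE.trans hpow') hV hψ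
      hrow hn (hpow.trans_lt hbig)
    have hzD : z ∈ D := Finset.mem_filter.2 ⟨mem_netData hz1 hz2, hz3⟩
    refine hgood (Set.mem_iUnion₂.2 ⟨z, hzD, ?_⟩)
    refine le_trans ?_ (card_large_lastLine_le (by positivity) hb hfew)
    refine Nat.cast_le.2 (Finset.card_le_card fun s hs => ?_)
    rw [Finset.mem_filter, Finset.mem_range] at hs ⊢
    refine ⟨hs.1, hs.2.1, ?_⟩
    by_contra! hle
    exact (hz4 s hs.1 _ (lastLine_lt hb s).1 hle).not_gt hs.2.2
  · rw [measure_pi_exists_notMem_eq_zero _ measurableSet_Icc fun n : Λ => hsupp n.1, zero_add]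
    calc Measure.pi (fun n : Λ => μ n.1) (⋃ z ∈ D, bad z)
        ≤ ∑ z ∈ D, Measure.pi (fun n : Λ => μ n.1) (bad z) := measure_biUnion_finset_le _ _
      _ ≤ ∑ _z ∈ D, ENNReal.ofReal (Real.exp (-(ρ / 8 - ρ / 32) * a)) := Finset.sum_le_sum hbadle
      _ = ENNReal.ofReal (D.card * Real.exp (-(ρ / 8 - ρ / 32) * a)) := by
          rw [Finset.sum_const, nsmul_eq_mul, ENNReal.ofReal_mul (Nat.cast_nonneg _),
            ENNReal.ofReal_natCast]
      _ ≤ ENNReal.ofReal (Real.exp (-(ρ / 32) * a)) := by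
          refine ENNReal.ofReal_le_ofReal (le_trans ?_ (Real.exp_le_exp.2 hexp))
          rw [Real.exp_add]
          gcongr
end
end

section
/- There exists ε₀ > 0 such that for all 0 < ν < ε ≤ ε₀ and every integer K ≥ 1 there is a constant C_{ε,ν,K} with the following property. Let V : ℤ² → ℝ and E ∈ ℝ, and suppose: (1) L₀ ≥ L₁ ≥ … ≥ L₆ ≥ C_{ε,ν,K} are powers of 2 with (1−ε)·log₂ L_k ≥ log₂ L_{k+1} for 0 ≤ k ≤ 5; (2) 1 ≥ m ≥ 2L₅^{−ν}; (3) Λ ⊆ ℤ² is a square of side length L₀ and H_Λ − E·I is invertible; (4) Λ'₁,…,Λ'_K ⊆ Λ are pairwise disjoint squares of side length L₂ such that each H_{Λ'_k} − E·I is invertible with operator norm ‖(H_{Λ'_k} − E·I)⁻¹‖ ≤ e^{L₄}; (5) for every x ∈ Λ at least one of the following holds: (i) x ∈ Λ'_k for some k and dist(x, Λ\Λ'_k) ≥ L₂/8, or (ii) there is a square Λ'' ⊆ Λ of side length L₅ with x ∈ Λ'', dist(x, Λ\Λ'') ≥ L₅/8, H_{Λ''} − E·I invertible, and |(H_{Λ''}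 − E·I)⁻¹(y,z)| ≤ e^{L₆ − m|y−z|} for all y, z ∈ Λ''. Then |(H_Λ − E·I)⁻¹(x,y)| ≤ e^{L₁ − m̃|x−y|} for all x, y ∈ Λ, where m̃ = m − L₅^{−ν}. -/
open MeasureTheory ProbabilityTheory
open scoped Classical

noncomputable section

/-- Nearest-neighbour adjacency in `ℤ²`. -/
def LatAdj (u v : ℤ × ℤ) : Prop :=
  (u.1 - v.1).natAbs + (u.2 - v.2).natAbs = 1

/-- The embedding `ℤ² → ℂ`. -/
def latToComplex (x : ℤ × ℤ) : ℂ := ⟨x.1, x.2⟩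

theorem eudist_eq_dist (x y : ℤ × ℤ) : eudist x y = dist (latToComplex x) (latToComplex y) := by
  rw [Complex.dist_eq_re_im]
  simp [eudist, latToComplex]

theorem LatAdj.eudist_eq_one {u v : ℤ × ℤ} (h : LatAdj u v) : eudist u v = 1 := by
  unfold LatAdj at h
  have h2 : (u.1 - v.1) ^ 2 + (u.2 - v.2) ^ 2 = 1 := by
    rcases (by lia : (u.1 - v.1 = 0 ∧ u.2 - v.2 = 1) ∨ (u.1 - v.1 = 0 ∧ u.2 - v.2 = -1) ∨
      (u.1 - v.1 = 1 ∧ u.2 - v.2 = 0) ∨ (u.1 - v.1 = -1 ∧ u.2 - v.2 = 0)) with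
      ⟨h1, h2⟩ | ⟨h1, h2⟩ | ⟨h1, h2⟩ | ⟨h1, h2⟩ <;> simp [h1, h2]
  unfold eudist
  rw [Real.sqrt_eq_one]
  exact_mod_cast h2

theorem eudist_le_of_abs_sub_le {x y : ℤ × ℤ} {L : ℕ} (h1 : |x.1 - y.1| ≤ L)
    (h2 : |x.2 - y.2| ≤ L) : eudist x y ≤ 2 * L := by
  unfold eudist
  refine Real.sqrt_le_iff.mpr ⟨by positivity, ?_⟩
  have h1' : |((x.1 - y.1 : ℤ) : ℝ)| ≤ L := by exact_mod_cast h1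
  have h2' : |((x.2 - y.2 : ℤ) : ℝ)| ≤ L := by exact_mod_cast h2
  have e1 := sq_le_sq' (abs_le.mp h1').1 (abs_le.mp h1').2
  have e2 := sq_le_sq' (abs_le.mp h2').1 (abs_le.mp h2').2
  nlinarith [sq_nonneg (L : ℝ)]

theorem mem_sqZ {a b : ℤ} {L : ℕ} {x : ℤ × ℤ} :
    x ∈ sqZ a b L ↔ (a ≤ x.1 ∧ x.1 ≤ a + L - 1) ∧ b ≤ x.2 ∧ x.2 ≤ b + L - 1 := by
  simp [sqZ, Finset.mem_product]

theorem card_sqZ (a b : ℤ) (L : ℕ) : (sqZ a b L).card = L ^ 2 := by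
  simp [sqZ, sq]

theorem card_filter_latAdj_le (S : Finset (ℤ × ℤ)) (u : ℤ × ℤ) :
    (S.filter (LatAdj u)).card ≤ 4 := by
  have : S.filter (LatAdj u) ⊆
      {(u.1 + 1, u.2), (u.1 - 1, u.2), (u.1, u.2 + 1), (u.1, u.2 - 1)} := by
    intro v hv
    have hv := (Finset.mem_filter.mp hv).2
    unfold LatAdj at hv
    simp only [Finset.mem_insert, Finset.mem_singleton, Prod.ext_iff]
    lia
  exact (Finset.card_le_card this).trans Finset.card_le_four

/-- Restricting `(H_Λ - E) G = 1` to `S ⊆ Λ`: geometric resolvent equation. -/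
theorem resolvent_column_eq {V : ℤ × ℤ → ℝ} {E : ℝ} {Λ S : Finset (ℤ × ℤ)} (hS : S ⊆ Λ)
    (hΛ : IsUnit (Ham V Λ - E • (1 : Matrix Λ Λ ℝ)).det)
    (hSd : IsUnit (Ham V S - E • (1 : Matrix S S ℝ)).det) (y : Λ) (x : S) :
    entry ((Ham V Λ - E • (1 : Matrix Λ Λ ℝ))⁻¹) x y =
      ∑ u : S, ((Ham V S - E • (1 : Matrix S S ℝ))⁻¹) x u *
        ((if (u : ℤ × ℤ) = y then 1 else 0) +
          ∑ v ∈ (Λ \ S).filter (LatAdj u), entry ((Ham V Λ - E • (1 : Matrix Λ Λ ℝ))⁻¹) v y) := by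
  set A := Ham V Λ - E • (1 : Matrix Λ Λ ℝ) with hA
  set B := Ham V S - E • (1 : Matrix S S ℝ) with hB
  set φ : ℤ × ℤ → ℝ := fun v => entry A⁻¹ v y with hφ
  have hcol : B.mulVec (fun w : S => φ w) = fun u : S => ((if (u : ℤ × ℤ) = y then 1 else 0) +
      ∑ v ∈ (Λ \ S).filter (LatAdj u), φ v) := by
    funext u
    have h1 : (A * A⁻¹) ⟨u, hS u.2⟩ y = (if (u : ℤ × ℤ) = y then 1 else 0) := by
      rw [Matrix.mul_nonsing_inv _ hΛ, Matrix.one_apply]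
      simp [Subtype.ext_iff]
    set k : ℤ × ℤ → ℝ := fun v => (if (u : ℤ × ℤ) = v then 4 + V u - E
      else if LatAdj u v then -1 else 0) with hk
    have h2 : (A * A⁻¹) ⟨u, hS u.2⟩ y = ∑ v ∈ Λ, k v * φ v := by
      rw [Matrix.mul_apply, ← Finset.sum_coe_sort Λ (fun v => k v * φ v)]
      refine Finset.sum_congr rfl fun v _ => ?_
      have : entry A⁻¹ v y = A⁻¹ v y := by simp [entry]
      simp only [hφ, this]
      congr 1
      by_cases huv : (u : ℤ × ℤ) = v
      · simp [hA, Ham, hk, huv]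
      · simp [hA, Ham, hk, Subtype.ext_iff, huv, LatAdj]
        congr
    have h3 : B.mulVec (fun w : S => φ w) u = ∑ v ∈ S, k v * φ v := by
      rw [Matrix.mulVec, dotProduct, ← Finset.sum_coe_sort S (fun v => k v * φ v)]
      refine Finset.sum_congr rfl fun v _ => ?_
      congr 1
      by_cases huv : (u : ℤ × ℤ) = v
      · simp [hB, Ham, hk, Matrix.one_apply, Subtype.ext_iff, huv]
      · simp [hB, Ham, hk, Subtype.ext_iff, huv, LatAdj]
        congr
    have h4 : ∑ v ∈ Λ \ S, k v * φ v = - ∑ v ∈ (Λ \ S).filter (LatAdj u), φ v := by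
      rw [Finset.sum_filter, ← Finset.sum_neg_distrib]
      refine Finset.sum_congr rfl fun v hv => ?_
      have huv : (u : ℤ × ℤ) ≠ v := by
        rintro rfl
        exact (Finset.mem_sdiff.mp hv).2 u.2
      by_cases hadj : LatAdj u v <;> simp [hk, huv, hadj]
    have h5 := Finset.sum_sdiff (f := fun v => k v * φ v) hS
    rw [h3]
    linarith
  have hx : B⁻¹.mulVec (B.mulVec (fun w : S => φ w)) x = φ x := by
    rw [Matrix.mulVec_mulVec, Matrix.nonsing_inv_mul _ hSd, Matrix.one_mulVec]
  rw [hcol] at hx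
  exact hx.symm

theorem abs_resolvent_le {V : ℤ × ℤ → ℝ} {E : ℝ} {Λ S : Finset (ℤ × ℤ)} (hS : S ⊆ Λ)
    (hΛ : IsUnit (Ham V Λ - E • (1 : Matrix Λ Λ ℝ)).det)
    (hSd : IsUnit (Ham V S - E • (1 : Matrix S S ℝ)).det) (y : Λ) (x : S) {p q : ℝ}
    (hp0 : 0 ≤ p)
    (hp : ∀ u : S, (u : ℤ × ℤ) = y → |((Ham V S - E • (1 : Matrix S S ℝ))⁻¹) x u| ≤ p)
    (hq : ∀ u : S, ∀ v ∈ Λ, v ∉ S → LatAdj u v →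
      |((Ham V S - E • (1 : Matrix S S ℝ))⁻¹) x u| *
        |entry ((Ham V Λ - E • (1 : Matrix Λ Λ ℝ))⁻¹) v y| ≤ q) (hq0 : 0 ≤ q) :
    |entry ((Ham V Λ - E • (1 : Matrix Λ Λ ℝ))⁻¹) x y| ≤ p + 4 * S.card * q := by
  rw [resolvent_column_eq hS hΛ hSd y x]
  set φ : ℤ × ℤ → ℝ := fun v => entry ((Ham V Λ - E • (1 : Matrix Λ Λ ℝ))⁻¹) v y
  set R := (Ham V S - E • (1 : Matrix S S ℝ))⁻¹
  simp only [mul_add, Finset.sum_add_distrib]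
  refine (abs_add_le _ _).trans (add_le_add ?_ ?_)
  · by_cases hy : (y : ℤ × ℤ) ∈ S
    · rw [Finset.sum_eq_single ⟨y, hy⟩]
      · simpa using hp ⟨y, hy⟩ rfl
      · intro u _ hu
        rw [if_neg (fun h : (u : ℤ × ℤ) = y => hu (Subtype.ext h)), mul_zero]
      · simp
    · rw [Finset.sum_eq_zero]
      · simpa using hp0
      · intro u _
        rw [if_neg (fun h : (u : ℤ × ℤ) = y => hy (h ▸ u.2)), mul_zero]
  · calc |∑ u : S, R x u * ∑ v ∈ (Λ \ S).filter (LatAdj u), φ v|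
        ≤ ∑ u : S, |R x u * ∑ v ∈ (Λ \ S).filter (LatAdj u), φ v| :=
          Finset.abs_sum_le_sum_abs _ _
      _ ≤ ∑ _u : S, 4 * q := by
          refine Finset.sum_le_sum fun u _ => ?_
          rw [Finset.mul_sum]
          calc |∑ v ∈ (Λ \ S).filter (LatAdj u), R x u * φ v|
              ≤ ∑ v ∈ (Λ \ S).filter (LatAdj u), |R x u * φ v| :=
                Finset.abs_sum_le_sum_abs _ _
            _ ≤ ((Λ \ S).filter (LatAdj u)).card • q := by
                refine Finset.sum_le_card_nsmul _ _ _ fun v hv => ?_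
                obtain ⟨hv1, hv2⟩ := Finset.mem_filter.mp hv
                obtain ⟨hv3, hv4⟩ := Finset.mem_sdiff.mp hv1
                rw [abs_mul]
                exact hq u v hv3 hv4 hv2
            _ ≤ 4 * q := by
                rw [nsmul_eq_mul]
                have := card_filter_latAdj_le (Λ \ S) u
                gcongr
                exact_mod_cast this
      _ = 4 * S.card * q := by simp; ring

/-- A monotone collapse of finitely many intervals of radius `ℓ`. -/
theorem exists_collapse {ι : Type*} (s : Finset ι) (c : ι → ℝ) {ℓ : ℝ} (hℓ : 0 ≤ ℓ) :
    ∃ g : ℝ → ℝ, Monotone g ∧ (∀ r t, g r ≤ g t + |r - t|) ∧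
      (∀ r, r - 2 * s.card * ℓ ≤ g r) ∧ (∀ r, g r ≤ r) ∧
      ∀ k ∈ s, ∀ r t, |r - c k| ≤ ℓ → |t - c k| ≤ ℓ → g r = g t := by
  induction s using Finset.induction_on with
  | empty =>
    refine ⟨id, monotone_id, fun r t => ?_, by simp, by simp, by simp⟩
    have := le_abs_self (r - t)
    simp only [id]
    linarith
  | insert k s hk ih =>
    obtain ⟨g, hmono, hlip, hlow, hup, hconst⟩ := ih
    set α := g (c k - ℓ)
    set β := g (c k + ℓ)
    have hαβ : α ≤ β := hmono (by linarith)
    have hβα : β ≤ α + 2 * ℓ := by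
      have := hlip (c k + ℓ) (c k - ℓ)
      rwa [show c k + ℓ - (c k - ℓ) = 2 * ℓ by ring, abs_of_nonneg (by linarith)] at this
    set σ : ℝ → ℝ := fun z => z - (min (max z α) β - α) with hσ
    have hσmono : ∀ z w, z ≤ w → σ z ≤ σ w ∧ σ w ≤ σ z + (w - z) := by
      intro z w hzw
      simp only [hσ]
      grind
    have hσlow : ∀ z, z - 2 * ℓ ≤ σ z ∧ σ z ≤ z := by
      intro z
      simp only [hσ]
      grind
    have hσconst : ∀ z, α ≤ z → z ≤ β → σ z = α := by
      intro z h1 h2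
      simp only [hσ]
      grind
    refine ⟨fun r => σ (g r), fun r t hrt => (hσmono _ _ (hmono hrt)).1, fun r t => ?_,
      fun r => ?_, fun r => (hσlow _).2.trans (hup r), fun j hj r t hr ht => ?_⟩
    · rcases le_total (g r) (g t) with h | h
      · have := (hσmono _ _ h).1
        have := abs_nonneg (r - t)
        linarith
      · have := (hσmono _ _ h).2
        have := hlip r t
        linarith
    · have := (hσlow (g r)).1
      have := hlow r
      rw [Finset.card_insert_of_notMem hk]
      push_cast
      linarith
    · rcases Finset.mem_insert.mp hj with rfl | hj
      · rw [abs_le] at hr ht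
        have e : ∀ z, -ℓ ≤ z - c j ∧ z - c j ≤ ℓ → σ (g z) = α := fun z hz =>
          hσconst _ (hmono (by linarith [hz.1])) (hmono (by linarith [hz.2]))
        simp only [e r hr, e t ht]
      · simp only [hconst j hj r t hr ht]

/-- Truncated depth of `x` inside `D`, relative to the ambient set `Λ`. -/
def truncDepth (Λ D : Finset (ℤ × ℤ)) (d : ℝ) (x : ℤ × ℤ) : ℝ :=
  min (Metric.infDist (latToComplex x) (latToComplex '' {z | z ∈ Λ ∧ z ∉ D})) d

theorem truncDepth_le_add (Λ D : Finset (ℤ × ℤ)) (d : ℝ) (x v : ℤ × ℤ) :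
    truncDepth Λ D d x ≤ truncDepth Λ D d v + eudist x v := by
  have h := Metric.infDist_le_infDist_add_dist (s := latToComplex '' {z | z ∈ Λ ∧ z ∉ D})
    (x := latToComplex x) (y := latToComplex v)
  have h0 : 0 ≤ eudist x v := Real.sqrt_nonneg _
  rw [← eudist_eq_dist] at h
  unfold truncDepth
  grind

theorem truncDepth_nonneg (Λ D : Finset (ℤ × ℤ)) {d : ℝ} (hd : 0 ≤ d) (x : ℤ × ℤ) :
    0 ≤ truncDepth Λ D d x :=
  le_min Metric.infDist_nonneg hd

theorem truncDepth_le_one {Λ D : Finset (ℤ × ℤ)} {d : ℝ} {u v : ℤ × ℤ} (hu : u ∈ Λ)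
    (huD : u ∉ D) (huv : LatAdj u v) : truncDepth Λ D d v ≤ 1 := by
  refine (min_le_left _ _).trans ?_
  refine (Metric.infDist_le_dist_of_mem (Set.mem_image_of_mem latToComplex
    (show u ∈ {z | z ∈ Λ ∧ z ∉ D} from ⟨hu, huD⟩))).trans ?_
  rw [dist_comm, ← eudist_eq_dist, huv.eudist_eq_one]

theorem truncDepth_le_zero {Λ D : Finset (ℤ × ℤ)} {d : ℝ} {v : ℤ × ℤ} (hv : v ∈ Λ)
    (hvD : v ∉ D) : truncDepth Λ D d v ≤ 0 := by
  refine (min_le_left _ _).trans ?_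
  refine (Metric.infDist_le_dist_of_mem (Set.mem_image_of_mem latToComplex
    (show v ∈ {z | z ∈ Λ ∧ z ∉ D} from ⟨hv, hvD⟩))).trans ?_
  rw [dist_self]

theorem le_truncDepth {Λ D : Finset (ℤ × ℤ)} {d : ℝ} {x : ℤ × ℤ} (hne : ∃ z ∈ Λ, z ∉ D)
    (h : ∀ z ∈ Λ, z ∉ D → d ≤ eudist x z) : d ≤ truncDepth Λ D d x := by
  refine le_min ?_ le_rfl
  obtain ⟨z, hz, hzD⟩ := hne
  refine (Metric.le_infDist (Set.Nonempty.image _ (show {z | z ∈ Λ ∧ z ∉ D}.Nonempty from ⟨z, hz, hzD⟩))).mpr ?_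
  rintro _ ⟨w, ⟨hw, hwD⟩, rfl⟩
  rw [← eudist_eq_dist]
  exact h w hw hwD

theorem eventually_polynomial_mul_exp_le {ε ν c : ℝ} (hνε : ν < ε) (hν1 : ν < 1) (hc : 0 < c) :
    ∀ᶠ L : ℝ in Filter.atTop,
      8 * L ^ 2 * Real.exp (L ^ (1 - ε) + 1 - c * L ^ (1 - ν)) ≤ 1 := by
  have h1 := tendsto_rpow_neg_atTop (show 0 < ε - ν by linarith)
  have h2 : Real.log =o[Filter.atTop] fun L : ℝ => L ^ (1 - ν) :=
    isLittleO_log_rpow_atTop (by linarith)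
  have h3 : Filter.Tendsto (fun L : ℝ => L ^ (1 - ν)) Filter.atTop Filter.atTop :=
    tendsto_rpow_atTop (by linarith)
  filter_upwards [h1.eventually_le_const (show 0 < c / 4 by positivity), h2.bound (show 0 < c / 8 by positivity),
    h3.eventually_ge_atTop ((1 + Real.log 8) / (c / 4)), Filter.eventually_ge_atTop 1]
    with L e1 e2 e3 e4
  have hL : 0 < L := by linarith
  have hp : 0 ≤ L ^ (1 - ν) := by positivity
  replace e1 : L ^ (1 - ε) ≤ c / 4 * L ^ (1 - ν) := by
    rw [show 1 - ε = -(ε - ν) + (1 - ν) by ring, Real.rpow_add hL]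
    gcongr
  rw [Real.norm_of_nonneg (Real.log_nonneg e4), Real.norm_of_nonneg hp] at e2
  rw [div_le_iff₀ (by positivity)] at e3
  have e5 : 8 * L ^ 2 = Real.exp (Real.log 8 + 2 * Real.log L) := by
    rw [Real.exp_add, Real.exp_log (by norm_num), mul_comm 2, Real.exp_mul, Real.exp_log hL]
    norm_cast
  rw [e5, ← Real.exp_add, Real.exp_le_one_iff]
  have e6 : 0 ≤ c * L ^ (1 - ν) := by positivity
  linarith

theorem le_rpow_of_logb_le {x y t : ℝ} (hx : 0 < x) (hy : 0 < y)
    (h : Real.logb 2 x ≤ t * Real.logb 2 y) : x ≤ y ^ t := by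
  rw [← Real.logb_rpow_eq_mul_logb_of_pos hy] at h
  exact (Real.logb_le_logb (by norm_num) hx (by positivity)).mp h

theorem abs_apply_le_of_sqrt_sum_mulVec_le {ι : Type*} [Fintype ι] [DecidableEq ι]
    {R : Matrix ι ι ℝ} {C : ℝ}
    (h : ∀ ψ : ι → ℝ, Real.sqrt (∑ z, (R.mulVec ψ z) ^ 2) ≤ C * Real.sqrt (∑ z, ψ z ^ 2))
    (x u : ι) : |R x u| ≤ C := by
  have h1 := h (Pi.single u 1)
  have h2 : ∑ z, (Pi.single u (1 : ℝ) : ι → ℝ) z ^ 2 = 1 := by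
    rw [Finset.sum_eq_single u] <;> simp +contextual
  rw [h2, Real.sqrt_one, mul_one, Matrix.mulVec_single_one] at h1
  refine (Real.abs_le_sqrt ?_).trans h1
  exact Finset.single_le_sum (f := fun z => R.col u z ^ 2) (fun _ _ => sq_nonneg _)
    (Finset.mem_univ x)

set_option maxHeartbeats 1000000 in
/-- deterministic multiscale step. There is `ε₀ > 0` such that for all
`0 < ν < ε ≤ ε₀` and `K ≥ 1` there is a constant `Cc` so that, under the hypotheses
(1)–(5) below, `|(H_Λ − E)⁻¹(x,y)| ≤ e^{L₁ − m̃|x−y|}` for all `x, y ∈ Λ`, where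
`m̃ = m − L₅^{−ν}`. -/
theorem stmt_18 :
    ∃ ε₀ > (0:ℝ), ∀ ε ν : ℝ, 0 < ν → ν < ε → ε ≤ ε₀ → ∀ K : ℕ, 1 ≤ K →
    ∃ Cc : ℝ,
    ∀ (V : ℤ × ℤ → ℝ) (E : ℝ) (L₀ L₁ L₂ L₃ L₄ L₅ L₆ : ℕ) (a b : ℤ)
      (Λ' : Fin K → Finset (ℤ × ℤ)) (m : ℝ),
      -- (1) dyadic, decreasing, large, compatible scales
      ((∃ i, L₀ = 2 ^ i) ∧ (∃ i, L₁ = 2 ^ i) ∧ (∃ i, L₂ = 2 ^ i) ∧ (∃ i, L₃ = 2 ^ i) ∧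
        (∃ i, L₄ = 2 ^ i) ∧ (∃ i, L₅ = 2 ^ i) ∧ (∃ i, L₆ = 2 ^ i)) →
      (L₆ ≤ L₅ ∧ L₅ ≤ L₄ ∧ L₄ ≤ L₃ ∧ L₃ ≤ L₂ ∧ L₂ ≤ L₁ ∧ L₁ ≤ L₀) →
      Cc ≤ (L₆ : ℝ) →
      (Real.logb 2 (L₁ : ℝ) ≤ (1 - ε) * Real.logb 2 (L₀ : ℝ) ∧
       Real.logb 2 (L₂ : ℝ) ≤ (1 - ε) * Real.logb 2 (L₁ : ℝ) ∧
       Real.logb 2 (L₃ : ℝ) ≤ (1 - ε) * Real.logb 2 (L₂ : ℝ) ∧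
       Real.logb 2 (L₄ : ℝ) ≤ (1 - ε) * Real.logb 2 (L₃ : ℝ) ∧
       Real.logb 2 (L₅ : ℝ) ≤ (1 - ε) * Real.logb 2 (L₄ : ℝ) ∧
       Real.logb 2 (L₆ : ℝ) ≤ (1 - ε) * Real.logb 2 (L₅ : ℝ)) →
      -- (2) the decay rate m
      m ≤ 1 → 2 * (L₅ : ℝ) ^ (-ν) ≤ m →
      -- (3) Λ = sqZ a b L₀ and H_Λ − E is invertible
      IsUnit (Ham V (sqZ a b L₀) - E • (1 : Matrix (sqZ a b L₀) (sqZ a b L₀) ℝ)).det →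
      -- (4) pairwise disjoint defect squares of side length L₂ with resolvent bound e^{L₄}
      (∀ k, ∃ a' b' : ℤ, Λ' k = sqZ a' b' L₂ ∧ Λ' k ⊆ sqZ a b L₀) →
      (∀ k k', k ≠ k' → Disjoint (Λ' k) (Λ' k')) →
      (∀ k, IsUnit (Ham V (Λ' k) - E • (1 : Matrix (Λ' k) (Λ' k) ℝ)).det ∧
        ∀ ψ : Λ' k → ℝ,
          Real.sqrt (∑ z : Λ' k,
              (((Ham V (Λ' k) - E • (1 : Matrix (Λ' k) (Λ' k) ℝ))⁻¹.mulVec ψ) z) ^ 2) ≤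
            Real.exp (L₄ : ℝ) * Real.sqrt (∑ z : Λ' k, ψ z ^ 2)) →
      -- (5) every point is deep inside a defect square or a good L₅-square
      (∀ x ∈ sqZ a b L₀,
        (∃ k, x ∈ Λ' k ∧ ∀ y ∈ sqZ a b L₀, y ∉ Λ' k → (L₂ : ℝ) / 8 ≤ eudist x y) ∨
        (∃ a'' b'' : ℤ, x ∈ sqZ a'' b'' L₅ ∧ sqZ a'' b'' L₅ ⊆ sqZ a b L₀ ∧
          (∀ y ∈ sqZ a b L₀, y ∉ sqZ a'' b'' L₅ → (L₅ : ℝ) / 8 ≤ eudist x y) ∧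
          IsUnit (Ham V (sqZ a'' b'' L₅)
              - E • (1 : Matrix (sqZ a'' b'' L₅) (sqZ a'' b'' L₅) ℝ)).det ∧
          ∀ y z : sqZ a'' b'' L₅,
            |((Ham V (sqZ a'' b'' L₅) - E • 1)⁻¹) y z| ≤
              Real.exp ((L₆ : ℝ) - m * eudist y.1 z.1))) →
      -- conclusion
      ∀ x y : sqZ a b L₀,
        |((Ham V (sqZ a b L₀) - E • 1)⁻¹) x y| ≤
          Real.exp ((L₁ : ℝ) - (m - (L₅ : ℝ) ^ (-ν)) * eudist x.1 y.1) := by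
  refine ⟨1 / 2, by norm_num, fun ε ν hν hνε hε K hK => ?_⟩
  have hK1 : (1 : ℝ) ≤ K := by exact_mod_cast hK
  obtain ⟨C₁, hC₁⟩ := Filter.eventually_atTop.mp
    (eventually_polynomial_mul_exp_le (c := 1 / (64 * K)) hνε (by linarith) (by positivity))
  obtain ⟨C₂, hC₂⟩ := Filter.eventually_atTop.mp
    ((tendsto_rpow_atTop (show 0 < ε by linarith)).eventually_ge_atTop (8 * (K : ℝ) + 5))
  refine ⟨max (max C₁ C₂) 1, ?_⟩
  rintro V E L₀ L₁ L₂ L₃ L₄ L₅ L₆ a b Λ' m - ⟨h65, h54, h43, h32, h21, h10⟩ hC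
    ⟨-, hl12, -, hl34, -, hl56⟩ hm1 hm hdet hsq hdisj hdef hcover
  have hL6C : max C₁ C₂ ≤ (L₆ : ℝ) := (le_max_left _ _).trans hC
  have hL6 : (1 : ℝ) ≤ L₆ := (le_max_right _ _).trans hC
  have h65' : (L₆ : ℝ) ≤ L₅ := by exact_mod_cast h65
  have h54' : (L₅ : ℝ) ≤ L₄ := by exact_mod_cast h54
  have h43' : (L₄ : ℝ) ≤ L₃ := by exact_mod_cast h43
  have h32' : (L₃ : ℝ) ≤ L₂ := by exact_mod_cast h32
  have h21' : (L₂ : ℝ) ≤ L₁ := by exact_mod_cast h21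
  have h10' : (L₁ : ℝ) ≤ L₀ := by exact_mod_cast h10
  have e6 : (L₆ : ℝ) ≤ (L₅ : ℝ) ^ (1 - ε) :=
    le_rpow_of_logb_le (by linarith) (by linarith) hl56
  have e4 : (L₄ : ℝ) ≤ (L₂ : ℝ) ^ (1 - ε) :=
    (le_rpow_of_logb_le (by linarith) (by linarith) hl34).trans
      (Real.rpow_le_rpow (by linarith) h32' (by linarith))
  have e2 : (8 * K + 5) * (L₂ : ℝ) ≤ L₁ := by
    have e := le_rpow_of_logb_le (by linarith) (by linarith) hl12
    have e' := hC₂ L₁ (((le_max_right _ _).trans hL6C).trans (by linarith))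
    calc (8 * K + 5) * (L₂ : ℝ) ≤ (L₁ : ℝ) ^ ε * (L₁ : ℝ) ^ (1 - ε) := by gcongr
      _ = L₁ := by
        rw [← Real.rpow_add (by linarith), add_sub_cancel, Real.rpow_one]
  set τ : ℝ := (L₅ : ℝ) ^ (-ν) with hτ
  have hτ0 : 0 < τ := Real.rpow_pos_of_pos (by linarith) _
  have hτ1 : τ ≤ 1 := Real.rpow_le_one_of_one_le_of_nonpos (by linarith) (by linarith)
  have hA : 8 * (L₅ : ℝ) ^ 2 * Real.exp (L₆ + 1 - τ * L₅ / (64 * K)) ≤ 1 := by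
    refine le_trans ?_ (hC₁ L₅ (((le_max_left _ _).trans hL6C).trans h65'))
    have : (L₅ : ℝ) ^ (1 - ν) = τ * L₅ := by
      rw [sub_eq_neg_add, Real.rpow_add (by linarith), Real.rpow_one]
    rw [this, show 1 / (64 * (K : ℝ)) * (τ * L₅) = τ * L₅ / (64 * K) by ring]
    gcongr
  have hB : 8 * (L₂ : ℝ) ^ 2 * Real.exp (L₄ + 1 - τ * L₂ / (64 * K)) ≤ 1 := by
    refine le_trans ?_ (hC₁ L₂ (((le_max_left _ _).trans hL6C).trans (by linarith)))
    have : (L₂ : ℝ) ^ (1 - ν) ≤ τ * L₂ := by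
      rw [sub_eq_neg_add, Real.rpow_add (by linarith), Real.rpow_one]
      have := Real.rpow_le_rpow_of_nonpos (by linarith) (by linarith : (L₅ : ℝ) ≤ L₂)
        (by linarith : -ν ≤ 0)
      gcongr
    rw [show τ * L₂ / (64 * K) = 1 / (64 * (K : ℝ)) * (τ * L₂) by ring]
    gcongr
  set Λ := sqZ a b L₀ with hΛ
  intro x y
  choose a' b' hΛ' hsub using hsq
  obtain ⟨g, -, hglip, hglow, hgup, hgconst⟩ :=
    exists_collapse (Finset.univ : Finset (Fin K)) (fun k => eudist (a' k, b' k) y)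
      (show (0 : ℝ) ≤ 2 * L₂ by positivity)
  rw [Finset.card_univ, Fintype.card_fin] at hglow
  set dep : ℤ × ℤ → ℝ := fun z => ∑ k, truncDepth Λ (Λ' k) (L₂ / 8) z with hdep
  have hdep_lip : ∀ z w, dep w ≤ dep z + K * eudist w z := by
    intro z w
    calc dep w ≤ ∑ k : Fin K, (truncDepth Λ (Λ' k) (L₂ / 8) z + eudist w z) :=
          Finset.sum_le_sum fun k _ => truncDepth_le_add _ _ _ _ _
      _ = dep z + K * eudist w z := by simp [Finset.sum_add_distrib, hdep]
  have hdep_up : ∀ z, dep z ≤ K * (L₂ / 8) := by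
    intro z
    calc dep z ≤ ∑ _k : Fin K, (L₂ / 8 : ℝ) := Finset.sum_le_sum fun k _ => min_le_right _ _
      _ = K * (L₂ / 8) := by simp
  have hdep_nonneg : ∀ z, 0 ≤ dep z := fun z =>
    Finset.sum_nonneg fun k _ => truncDepth_nonneg _ _ (by positivity) _
  have hcomm : ∀ z w, eudist z w = eudist w z := fun z w => by
    rw [eudist_eq_dist, eudist_eq_dist, dist_comm]
  have htri : ∀ z w t, eudist z t ≤ eudist z w + eudist w t := fun z w t => by
    simp only [eudist_eq_dist]
    exact dist_triangle _ _ _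
  have hnn : ∀ z w, 0 ≤ eudist z w := fun z w => Real.sqrt_nonneg _
  set mt : ℝ := m - τ with hmt
  have hmt0 : 0 < mt := by linarith
  have hmt1 : mt ≤ 1 := by linarith
  set s : ℝ := τ / (4 * K) with hs
  have hs0 : 0 < s := by positivity
  have hsK : s * K = τ / 4 := by rw [hs]; field_simp
  set ω : ℤ × ℤ → ℝ := fun z => mt * g (eudist z y) - s * dep z with hω
  have hω_up : ∀ z, ω z ≤ mt * eudist z y := by
    intro z
    have := mul_le_mul_of_nonneg_left (hgup (eudist z y)) hmt0.le
    have := mul_nonneg hs0.le (hdep_nonneg z)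
    simp only [hω]
    linarith
  have hω_lip : ∀ z w, ω z - ω w ≤ (mt + τ / 4) * eudist z w := by
    intro z w
    have h1 : g (eudist z y) ≤ g (eudist w y) + eudist z w := by
      refine (hglip _ (eudist w y)).trans ?_
      have : |eudist z y - eudist w y| ≤ eudist z w := by
        rw [abs_le]
        constructor <;> linarith [htri z w y, htri w z y, hcomm z w]
      linarith
    have h2 := hdep_lip z w
    rw [hcomm] at h2
    have h3 := mul_le_mul_of_nonneg_left h1 hmt0.le
    have h4 := mul_le_mul_of_nonneg_left h2 hs0.le
    simp only [hω]
    rw [← hsK]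
    linarith
  set G := (Ham V Λ - E • (1 : Matrix Λ Λ ℝ))⁻¹ with hG
  set F : ℤ × ℤ → ℝ := fun z => |entry G z y| with hF
  obtain ⟨x₀, hx₀, hmax⟩ := Finset.exists_max_image Λ (fun z => F z * Real.exp (ω z)) ⟨y, y.2⟩
  set M := F x₀ * Real.exp (ω x₀) with hM
  have hM0 : 0 ≤ M := by positivity
  have hFM : ∀ z ∈ Λ, F z ≤ M * Real.exp (-ω z) := by
    intro z hz
    have := hmax z hz
    rw [Real.exp_neg, ← div_eq_mul_inv, le_div_iff₀ (Real.exp_pos _)]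
    exact this
  have hclose : ∀ N B D : ℝ, 8 * N * Real.exp B ≤ 1 →
      F x₀ ≤ Real.exp (D - ω x₀) + 4 * N * (Real.exp (B - ω x₀) * M) →
      M ≤ 2 * Real.exp D := by
    intro N B D h1 h2
    have h3 := mul_le_mul_of_nonneg_right h2 (Real.exp_pos (ω x₀)).le
    have h4 : (Real.exp (D - ω x₀) + 4 * N * (Real.exp (B - ω x₀) * M)) * Real.exp (ω x₀) =
        Real.exp D + 4 * N * Real.exp B * M := by
      rw [sub_eq_add_neg, sub_eq_add_neg, Real.exp_add, Real.exp_add, Real.exp_neg]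
      field_simp
    rw [h4] at h3
    have h5 := mul_le_mul_of_nonneg_right h1 hM0
    linarith
  have hMle : M ≤ 2 * Real.exp (L₄ + 2 * L₂) := by
    rcases hcover x₀ hx₀ with ⟨k, hxk, hdeep⟩ | ⟨a'', b'', hxS, hSsub, hdeep, hSdet, hSbd⟩
    · refine hclose ((L₂ : ℝ) ^ 2) _ _ hB ?_
      have hent := abs_apply_le_of_sqrt_sum_mulVec_le (hdef k).2
      have hcard : ((Λ' k).card : ℝ) = (L₂ : ℝ) ^ 2 := by
        rw [hΛ' k, card_sqZ]
        push_cast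
        rfl
      rw [← hcard]
      have hlt : (L₂ : ℝ) < L₀ := by nlinarith
      have hne : ∃ z ∈ Λ, z ∉ Λ' k := by
        by_contra! hcon
        have h1 := Finset.card_le_card (show Λ ⊆ Λ' k from hcon)
        rw [hΛ' k, hΛ, card_sqZ, card_sqZ] at h1
        have h2 : L₂ < L₀ := by exact_mod_cast hlt
        exact absurd h1 (not_le.mpr (Nat.pow_lt_pow_left h2 (by norm_num)))
      have hdepx : (L₂ : ℝ) / 8 ≤ dep x₀ :=
        (le_truncDepth hne hdeep).trans
          (Finset.single_le_sum (f := fun k => truncDepth Λ (Λ' k) (L₂ / 8) x₀)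
            (fun j _ => truncDepth_nonneg _ _ (by positivity) _) (Finset.mem_univ k))
      have hmem : ∀ z ∈ Λ' k, (a' k ≤ z.1 ∧ z.1 ≤ a' k + L₂ - 1) ∧
          b' k ≤ z.2 ∧ z.2 ≤ b' k + L₂ - 1 := by
        intro z hz
        rw [hΛ' k] at hz
        exact mem_sqZ.mp hz
      refine abs_resolvent_le (hsub k) hdet (hdef k).1 y ⟨x₀, hxk⟩ (Real.exp_pos _).le ?_ ?_
        (by positivity)
      · intro u hu
        refine (hent ⟨x₀, hxk⟩ u).trans (Real.exp_le_exp.mpr ?_)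
        have h1 := hω_up x₀
        have h2 : eudist x₀ y ≤ 2 * L₂ := by
          have hx := hmem x₀ hxk
          have hy := hmem y (hu ▸ u.2)
          apply eudist_le_of_abs_sub_le <;> rw [abs_le] <;> lia
        have h3 : mt * eudist x₀ y ≤ 1 * (2 * L₂) :=
          mul_le_mul hmt1 h2 (hnn _ _) (by norm_num)
        linarith
      · intro u v hv hvk huv
        have hx := hmem x₀ hxk
        have hu := hmem u u.2
        have hgeq : g (eudist x₀ y) = g (eudist v y) := by
          refine hgconst k (Finset.mem_univ k) _ _ ?_ ?_
          · have : eudist x₀ (a' k, b' k) ≤ 2 * L₂ := by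
              apply eudist_le_of_abs_sub_le <;> rw [abs_le] <;> lia
            rw [abs_le]
            constructor <;> linarith [htri x₀ (a' k, b' k) y, htri (a' k, b' k) x₀ y,
              hcomm x₀ (a' k, b' k)]
          · have : eudist v (a' k, b' k) ≤ 2 * L₂ := by
              unfold LatAdj at huv
              apply eudist_le_of_abs_sub_le <;> rw [abs_le] <;> lia
            rw [abs_le]
            constructor <;> linarith [htri v (a' k, b' k) y, htri (a' k, b' k) v y,
              hcomm v (a' k, b' k)]
        have hdepv : dep v ≤ K := by
          calc dep v ≤ ∑ _j : Fin K, (1 : ℝ) := by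
                refine Finset.sum_le_sum fun j _ => ?_
                by_cases hvj : v ∈ Λ' j
                · have hjk : k ≠ j := fun h => hvk (h ▸ hvj)
                  exact truncDepth_le_one (hsub k u.2)
                    (Finset.disjoint_left.mp (hdisj k j hjk) u.2) huv
                · exact (truncDepth_le_zero hv hvj).trans zero_le_one
            _ = K := by simp
        have hωd : ω x₀ - ω v ≤ 1 - τ * L₂ / (64 * K) := by
          have h1 := mul_le_mul_of_nonneg_left hdepx hs0.le
          have h2 := mul_le_mul_of_nonneg_left hdepv hs0.le
          have h3 : s * (L₂ / 8) = 2 * (τ * L₂ / (64 * K)) := by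
            rw [hs]
            field_simp
            ring
          have h4 : 0 ≤ τ * L₂ / (64 * K) := by positivity
          simp only [hω, hgeq]
          linarith
        calc _ ≤ Real.exp L₄ * (M * Real.exp (-ω v)) :=
              mul_le_mul (hent ⟨x₀, hxk⟩ u) (hFM v hv) (abs_nonneg _) (Real.exp_pos _).le
          _ = Real.exp (L₄ + -ω v) * M := by rw [Real.exp_add]; ring
          _ ≤ _ := by
              refine mul_le_mul_of_nonneg_right (Real.exp_le_exp.mpr ?_) hM0
              linarith
    · refine (hclose ((L₅ : ℝ) ^ 2) _ L₆ hA ?_).trans ?_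
      · have hcard : ((sqZ a'' b'' L₅).card : ℝ) = (L₅ : ℝ) ^ 2 := by
          rw [card_sqZ]
          push_cast
          rfl
        rw [← hcard]
        refine abs_resolvent_le hSsub hdet hSdet y ⟨x₀, hxS⟩ (Real.exp_pos _).le ?_ ?_
          (by positivity)
        · intro u hu
          refine (hSbd ⟨x₀, hxS⟩ u).trans (Real.exp_le_exp.mpr ?_)
          rw [hu]
          have h1 := hω_up x₀
          have h2 : mt * eudist x₀ y ≤ m * eudist x₀ y :=
            mul_le_mul_of_nonneg_right (by linarith) (hnn _ _)
          linarith
        · intro u v hv hvS huv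
          have h1 := hω_lip x₀ v
          have h2 : eudist x₀ v ≤ eudist x₀ u + 1 := huv.eudist_eq_one ▸ htri x₀ u v
          have h3 := hdeep v hv hvS
          have h4 : m * eudist x₀ v ≤ m * eudist x₀ u + 1 := by
            have := mul_le_mul_of_nonneg_left h2 (by linarith : 0 ≤ m)
            linarith
          have h5 : τ * (L₅ / 8) ≤ τ * eudist x₀ v := mul_le_mul_of_nonneg_left h3 hτ0.le
          have h6 : τ * L₅ / (64 * K) ≤ τ * L₅ / 64 := by
            gcongr
            linarith
          have h7 : 0 ≤ τ * L₅ := by positivity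
          calc _ ≤ Real.exp (L₆ - m * eudist x₀ u) * (M * Real.exp (-ω v)) :=
                mul_le_mul (hSbd ⟨x₀, hxS⟩ u) (hFM v hv) (abs_nonneg _) (Real.exp_pos _).le
            _ = Real.exp (L₆ - m * eudist x₀ u + -ω v) * M := by rw [Real.exp_add]; ring
            _ ≤ _ := by
                refine mul_le_mul_of_nonneg_right (Real.exp_le_exp.mpr ?_) hM0
                rw [hmt] at h1
                linarith
      · gcongr
        linarith
  have hxF : |G x y| = F x := by simp [hF, entry]
  have hωx : -ω x ≤ 4 * K * L₂ + L₂ - mt * eudist x y := by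
    have h1 := mul_le_mul_of_nonneg_left (hglow (eudist x y)) hmt0.le
    have h2 := mul_le_mul_of_nonneg_left (hdep_up x) hs0.le
    have h3 : mt * (4 * K * L₂) ≤ 1 * (4 * K * L₂) :=
      mul_le_mul_of_nonneg_right hmt1 (by positivity)
    have h4 : s * (K * (L₂ / 8)) = τ * L₂ / 32 := by
      rw [← mul_assoc, hsK]
      ring
    have h5 : τ * L₂ ≤ 1 * L₂ := mul_le_mul_of_nonneg_right hτ1 (by positivity)
    simp only [hω]
    linarith
  have h2e : (2 : ℝ) ≤ Real.exp 1 := by linarith [Real.add_one_le_exp (1 : ℝ)]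
  have hKL : (L₂ : ℝ) ≤ K * L₂ := le_mul_of_one_le_left (by positivity) hK1
  rw [hxF]
  calc F x ≤ M * Real.exp (-ω x) := hFM x x.2
    _ ≤ Real.exp 1 * Real.exp (L₄ + 2 * L₂) * Real.exp (-ω x) := by
        gcongr
        exact hMle.trans (by gcongr)
    _ = Real.exp (1 + (L₄ + 2 * L₂) + -ω x) := by
        rw [Real.exp_add (1 + (L₄ + 2 * L₂ : ℝ)), Real.exp_add 1]
    _ ≤ _ := Real.exp_le_exp.mpr (by linarith)
end
end
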